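/- arXiv:2502.00770 — 5 statements merged into one kernel-verified Lean document; each statement's English description precedes it below -/
import Mathlib

section
/- Let q be a prime power and m a prime that does not divide q−1. Consider the set of pairs (σ, a) where σ is a generator of Gal(𝔽_{q^m}/𝔽_q) and a ∈ 𝔽_{q^m} ∖ 𝔽_q, and declare (σ₁, a₁) and (σ₂, a₂) equivalent if the nonassociative cyclic algebras (𝔽_{q^m}/𝔽_q, σ₁, a₁) and (𝔽_{q^m}/𝔽_q, σ₂, a₂) are isomorphic as 𝔽_q-algebras. Then each such algebra is a division algebra (a semifield of order q^{m²}), and the number of equivalence classes equals (m−1)(q^m−q)/(m(q−1)) (this rational number is an integer). -/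
/-- The multiplication of the nonassociative cyclic algebra
`(K/F,σ,a) = K[t;σ]/K[t;σ](t^m - a)`, on the `F`-vector space `Fin m → K`
(coordinates with respect to the `K`-basis `t^0, …, t^{m-1}`). -/
noncomputable def petitMul {F K : Type*} [Field F] [Field K] [Algebra F K]
    (σ : K ≃ₐ[F] K) (a : K) (m : ℕ) (x y : Fin m → K) : Fin m → K :=
  fun l =>
    (∑ i : Fin m, ∑ j : Fin m,
      if (i : ℕ) + (j : ℕ) = (l : ℕ) then x i * (σ ^ (i : ℕ)) (y j) else 0)
    + (∑ i : Fin m, ∑ j : Fin m,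
      if (i : ℕ) + (j : ℕ) = (l : ℕ) + m then
        x i * (σ ^ (i : ℕ)) (y j) * (σ ^ (l : ℕ)) a else 0)

/-- Isomorphism of Petit algebras as `F`-algebras: an `F`-linear bijection
preserving multiplication. -/
def PetitIso {F K : Type*} [Field F] [Field K] [Algebra F K]
    (σ₁ σ₂ : K ≃ₐ[F] K) (a₁ a₂ : K) (m : ℕ) : Prop :=
  ∃ e : (Fin m → K) ≃ₗ[F] (Fin m → K),
    ∀ x y : Fin m → K, e (petitMul σ₁ a₁ m x y) = petitMul σ₂ a₂ m (e x) (e y)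

/-- The monomial `c t^i`, as a coordinate vector of a Petit algebra. -/
def petitMono {K : Type*} [Zero K] (m i : ℕ) (c : K) : Fin m → K :=
  fun l => if (l : ℕ) = i then c else 0

theorem sum_sum_ite_add_eq_of_left {M : Type*} [AddCommMonoid M] {m : ℕ} (f : Fin m → Fin m → M)
    (i : Fin m) (hf : ∀ i', i' ≠ i → ∀ j, f i' j = 0) (n : ℕ) :
    (∑ i : Fin m, ∑ j : Fin m, if (i : ℕ) + (j : ℕ) = n then f i j else 0) =
      if h : (i : ℕ) ≤ n ∧ n - i < m then f i ⟨n - i, h.2⟩ else 0 := by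
  rw [Fintype.sum_eq_single i fun i' hi' => by simp [hf i' hi']]
  split_ifs with h
  · rw [Fintype.sum_eq_single ⟨n - i, h.2⟩, if_pos (by simp only; omega)]
    intro j hj
    rw [if_neg]
    contrapose! hj
    ext
    simp only
    omega
  · exact Finset.sum_eq_zero fun j _ => if_neg (by omega)

theorem sum_sum_ite_add_eq_of_right {M : Type*} [AddCommMonoid M] {m : ℕ} (f : Fin m → Fin m → M)
    (j : Fin m) (hf : ∀ i j', j' ≠ j → f i j' = 0) (n : ℕ) :
    (∑ i : Fin m, ∑ j : Fin m, if (i : ℕ) + (j : ℕ) = n then f i j else 0) =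
      if h : (j : ℕ) ≤ n ∧ n - j < m then f ⟨n - j, h.2⟩ j else 0 := by
  rw [Finset.sum_comm]
  simp only [add_comm (Fin.val _) (Fin.val _)]
  exact sum_sum_ite_add_eq_of_left (fun j i => f i j) j (fun j' hj' i => hf i j' hj') n

section Petit

variable {F K : Type*} [Field F] [Field K] [Algebra F K] {σ : K ≃ₐ[F] K} {a : K} {m : ℕ}

theorem petitMono_apply_of_ne {i : ℕ} (hi : i < m) (c : K) {l : Fin m} (hl : l ≠ ⟨i, hi⟩) :
    petitMono m i c l = 0 :=
  if_neg fun h => hl (Fin.ext h)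

theorem petitMono_mul_apply {i : ℕ} (hi : i < m) (c : K) (y : Fin m → K) (l : Fin m) :
    petitMul σ a m (petitMono m i c) y l =
      if h : i ≤ l then c * (σ ^ i) (y ⟨l - i, by omega⟩)
      else c * (σ ^ i) (y ⟨l + m - i, by omega⟩) * (σ ^ (l : ℕ)) a := by
  refine (congrArg₂ (· + ·)
    (sum_sum_ite_add_eq_of_left (fun i' j => petitMono m i c i' * (σ ^ (i' : ℕ)) (y j)) ⟨i, hi⟩
      (fun i' hi' j => by simp only [petitMono_apply_of_ne hi c hi', zero_mul]) l)
    (sum_sum_ite_add_eq_of_left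
      (fun i' j => petitMono m i c i' * (σ ^ (i' : ℕ)) (y j) * (σ ^ (l : ℕ)) a) ⟨i, hi⟩
      (fun i' hi' j => by simp only [petitMono_apply_of_ne hi c hi', zero_mul]) (l + m))).trans ?_
  have hc : petitMono m i c ⟨i, hi⟩ = c := if_pos rfl
  simp only [hc]
  split_ifs <;> first | omega | simp

theorem mul_petitMono_apply {j : ℕ} (hj : j < m) (x : Fin m → K) (d : K) (l : Fin m) :
    petitMul σ a m x (petitMono m j d) l =
      if h : j ≤ l then x ⟨l - j, by omega⟩ * (σ ^ (l - j : ℕ)) d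
      else x ⟨l + m - j, by omega⟩ * (σ ^ (l + m - j : ℕ)) d * (σ ^ (l : ℕ)) a := by
  refine (congrArg₂ (· + ·)
    (sum_sum_ite_add_eq_of_right (fun i j' => x i * (σ ^ (i : ℕ)) (petitMono m j d j')) ⟨j, hj⟩
      (fun i j' hj' => by simp only [petitMono_apply_of_ne hj d hj', map_zero, mul_zero]) l)
    (sum_sum_ite_add_eq_of_right
      (fun i j' => x i * (σ ^ (i : ℕ)) (petitMono m j d j') * (σ ^ (l : ℕ)) a) ⟨j, hj⟩
      (fun i j' hj' => by
        simp only [petitMono_apply_of_ne hj d hj', map_zero, mul_zero, zero_mul]) (l + m))).trans ?_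
  have hd : petitMono m j d ⟨j, hj⟩ = d := if_pos rfl
  simp only [hd]
  split_ifs <;> first | omega | simp

theorem petitMono_mul_petitMono_of_lt {i j : ℕ} (h : i + j < m) (c d : K) :
    petitMul σ a m (petitMono m i c) (petitMono m j d) =
      petitMono m (i + j) (c * (σ ^ i) d) := by
  ext l
  rw [petitMono_mul_apply (by omega)]
  unfold petitMono
  simp only
  split_ifs <;> first | rfl | omega | simp only [map_zero, mul_zero, zero_mul]

theorem petitMono_mul_petitMono_of_le {i j : ℕ} (hi : i < m) (hj : j < m) (h : m ≤ i + j)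
    (c d : K) :
    petitMul σ a m (petitMono m i c) (petitMono m j d) =
      petitMono m (i + j - m) (c * (σ ^ i) d * (σ ^ (i + j - m)) a) := by
  ext l
  rw [petitMono_mul_apply (by omega)]
  unfold petitMono
  simp only
  split_ifs with h1 h2 h3 h4 h5
  all_goals first | omega | simp only [map_zero, mul_zero, zero_mul] | rw [‹(l : ℕ) = _›]

theorem petitMono_zero_one_mul (hm : 0 < m) (y : Fin m → K) :
    petitMul σ a m (petitMono m 0 1) y = y := by
  ext l
  simp [petitMono_mul_apply hm]

theorem mul_petitMono_zero_one (hm : 0 < m) (x : Fin m → K) :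
    petitMul σ a m x (petitMono m 0 1) = x := by
  ext l
  simp [mul_petitMono_apply hm]

theorem petitMul_eq_sum_smul (x y : Fin m → K) :
    petitMul σ a m x y = ∑ i : Fin m, x i • petitMul σ a m (petitMono m i 1) y := by
  ext l
  rw [Finset.sum_apply]
  unfold petitMul
  rw [← Finset.sum_add_distrib]
  refine Finset.sum_congr rfl fun i _ => ?_
  simp only [Pi.smul_apply, smul_eq_mul]
  rw [Fintype.sum_eq_single (f := fun i' : Fin m => ∑ j : Fin m,
      if (i' : ℕ) + (j : ℕ) = (l : ℕ) then petitMono m i 1 i' * (σ ^ (i' : ℕ)) (y j) else 0) i,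
    Fintype.sum_eq_single (f := fun i' : Fin m => ∑ j : Fin m,
      if (i' : ℕ) + (j : ℕ) = (l : ℕ) + m then
        petitMono m i 1 i' * (σ ^ (i' : ℕ)) (y j) * (σ ^ (l : ℕ)) a else 0) i]
  · have h1 : petitMono m i (1 : K) i = 1 := if_pos rfl
    rw [mul_add, Finset.mul_sum, Finset.mul_sum]
    congr 1 <;> refine Finset.sum_congr rfl fun j _ => ?_ <;>
      simp only [h1, mul_ite, one_mul, mul_zero, mul_assoc]
  all_goals
    intro b hb
    simp [petitMono_apply_of_ne i.2 (1 : K) hb]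

/-- An element of the left nucleus of a proper nonassociative cyclic algebra is a scalar. -/
theorem apply_eq_zero_of_mem_left_nucleus (hm : 1 < m) (ha : σ a ≠ a) {x : Fin m → K}
    (hx : ∀ y z, petitMul σ a m (petitMul σ a m x y) z = petitMul σ a m x (petitMul σ a m y z))
    (i : Fin m) (hi : (i : ℕ) ≠ 0) : x i = 0 := by
  have h := congrFun (hx (petitMono m (m - i) 1) (petitMono m 1 1)) ⟨1, hm⟩
  have h1 : petitMul σ a m (petitMul σ a m x (petitMono m (m - i) 1)) (petitMono m 1 1) ⟨1, hm⟩
      = x i * a := by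
    rw [mul_petitMono_apply hm, dif_pos le_rfl, mul_petitMono_apply (by omega),
      dif_neg (by simp only; omega)]
    have : (⟨1 - 1 + m - (m - i), by omega⟩ : Fin m) = i := by ext; simp only; omega
    rw [this]
    simp
  have h2 : petitMul σ a m x (petitMul σ a m (petitMono m (m - i) 1) (petitMono m 1 1)) ⟨1, hm⟩
      = x i * σ a := by
    by_cases hi1 : (i : ℕ) = 1
    · rw [petitMono_mul_petitMono_of_le (by omega) hm (by omega),
        show m - i + 1 - m = 0 by omega, mul_petitMono_apply (by omega), dif_pos (by simp)]
      have : (⟨1 - 0, by omega⟩ : Fin m) = i := by ext; simp only; omega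
      simp [this]
    · rw [petitMono_mul_petitMono_of_lt (by omega), mul_petitMono_apply (by omega),
        dif_neg (by simp only; omega)]
      have : (⟨1 + m - (m - i + 1), by omega⟩ : Fin m) = i := by ext; simp only; omega
      simp [this]
  rw [h1, h2] at h
  by_contra h0
  exact ha (mul_left_cancel₀ h0 h).symm

theorem petitMul_smul_left (c : K) (x y : Fin m → K) :
    petitMul σ a m (c • x) y = c • petitMul σ a m x y := by
  rw [petitMul_eq_sum_smul, petitMul_eq_sum_smul x, Finset.smul_sum]
  simp only [Pi.smul_apply, smul_assoc]

theorem petitMul_add_right (x y z : Fin m → K) :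
    petitMul σ a m x (y + z) = petitMul σ a m x y + petitMul σ a m x z := by
  ext l
  simp only [petitMul, Pi.add_apply, map_add, mul_add, add_mul, ← Finset.sum_add_distrib]
  refine Finset.sum_congr rfl fun i _ => Finset.sum_congr rfl fun j _ => ?_
  split_ifs <;> ring

theorem petitMono_one_mul_smul (hm : 1 < m) (c : K) (y : Fin m → K) :
    petitMul σ a m (petitMono m 1 1) (c • y) = σ c • petitMul σ a m (petitMono m 1 1) y := by
  ext l
  rw [Pi.smul_apply, petitMono_mul_apply hm, petitMono_mul_apply hm]
  split_ifs <;> simp [mul_assoc]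

theorem petitMul_zero_right (x : Fin m → K) : petitMul σ a m x 0 = 0 := by
  ext l
  simp [petitMul]

theorem petitMono_one_mul_petitMono_one_mul {i : ℕ} (hi : i + 1 < m) (y : Fin m → K) :
    petitMul σ a m (petitMono m 1 1) (petitMul σ a m (petitMono m i 1) y) =
      petitMul σ a m (petitMono m (i + 1) 1) y := by
  have hs (n : ℕ) (z : K) : σ ((σ ^ n) z) = (σ ^ (n + 1)) z := by
    rw [pow_succ', AlgEquiv.mul_apply]
  ext l
  rw [petitMono_mul_apply (by omega), petitMono_mul_apply hi]
  rcases Nat.eq_zero_or_pos (l : ℕ) with h | h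
  · rw [dif_neg (by omega), dif_neg (by omega), petitMono_mul_apply (by omega),
      dif_pos (by simp only; omega)]
    have : (⟨l + m - 1 - i, by omega⟩ : Fin m) = ⟨l + m - (i + 1), by omega⟩ := by
      ext; simp only; omega
    simp only [this, pow_one, one_mul, hs]
  · rw [dif_pos (by omega), petitMono_mul_apply (by omega)]
    simp only
    by_cases h1 : i + 1 ≤ l
    · rw [dif_pos (by omega), dif_pos h1]
      have : (⟨l - 1 - i, by omega⟩ : Fin m) = ⟨l - (i + 1), by omega⟩ := by
        ext; simp only; omega
      simp only [this, pow_one, one_mul, hs]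
    · rw [dif_neg (by omega), dif_neg h1]
      have : (⟨l - 1 + m - i, by omega⟩ : Fin m) = ⟨l + m - (i + 1), by omega⟩ := by
        ext; simp only; omega
      simp only [this, pow_one, one_mul, hs, map_mul, Nat.sub_add_cancel h]

/-- Multiplying `m` times by `t` is the diagonal operator with entries `σ ^ l a`. -/
theorem petitMono_one_mul_petitMono_pred_mul (hm : 1 < m) (hσ : σ ^ m = 1) (y : Fin m → K)
    (l : Fin m) :
    petitMul σ a m (petitMono m 1 1) (petitMul σ a m (petitMono m (m - 1) 1) y) l =
      (σ ^ (l : ℕ)) a * y l := by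
  have hs (z : K) : σ ((σ ^ (m - 1)) z) = z := by
    rw [← AlgEquiv.mul_apply, ← pow_succ', Nat.sub_add_cancel hm.le, hσ, AlgEquiv.one_apply]
  rw [petitMono_mul_apply hm]
  rcases Nat.eq_zero_or_pos (l : ℕ) with h | h
  · rw [dif_neg (by omega), petitMono_mul_apply (by omega), dif_pos (by simp only; omega)]
    have : (⟨l + m - 1 - (m - 1), by omega⟩ : Fin m) = l := by ext; simp only; omega
    simp only [this, pow_one, one_mul, hs]
    ring
  · rw [dif_pos (by omega), petitMono_mul_apply (by omega), dif_neg (by simp only; omega)]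
    have : (⟨l - 1 + m - (m - 1), by omega⟩ : Fin m) = l := by ext; simp only; omega
    have hl : (l : ℕ) = l - 1 + 1 := by omega
    simp only [this, pow_one, one_mul, map_mul, hs]
    conv_rhs => rw [hl, pow_succ', AlgEquiv.mul_apply]
    ring

/-- If `a` has trivial stabilizer among the powers of `σ`, then `K[t;σ]/K[t;σ](t^m - a)` is a
simple left module. -/
theorem eq_top_of_petitMono_one_mul_mem (hm : 1 < m) (hσ : σ ^ m = 1)
    (ha : ∀ i, 0 < i → i < m → (σ ^ i) a ≠ a) (W : Submodule K (Fin m → K))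
    (hW : ∀ v ∈ W, petitMul σ a m (petitMono m 1 1) v ∈ W) {y : Fin m → K} (hy : y ∈ W)
    (hy0 : y ≠ 0) : W = ⊤ := by
  have ha0 : a ≠ 0 := fun h => ha 1 one_pos hm (by simp [h])
  have hinj : ∀ i j : Fin m, i ≠ j → (σ ^ (i : ℕ)) a ≠ (σ ^ (j : ℕ)) a := by
    have key : ∀ i j : Fin m, i < j → (σ ^ (i : ℕ)) a ≠ (σ ^ (j : ℕ)) a := by
      intro i j hij h
      have hj : (j : ℕ) = i + (j - i) := by omega
      rw [hj, pow_add, AlgEquiv.mul_apply] at h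
      exact ha (j - i) (by omega) (by omega) ((σ ^ (i : ℕ)).injective h).symm
    intro i j hij
    rcases lt_or_gt_of_ne hij with h | h
    · exact key i j h
    · exact (key j i h).symm
  have hpow : ∀ i < m, ∀ v ∈ W, petitMul σ a m (petitMono m i 1) v ∈ W := by
    intro i
    induction i with
    | zero => intro h v hv; rwa [petitMono_zero_one_mul h]
    | succ i ih =>
      intro h v hv
      rw [← petitMono_one_mul_petitMono_one_mul h]
      exact hW _ (ih (by omega) v hv)
  have hdiag : ∀ v ∈ W, (fun l : Fin m => (σ ^ (l : ℕ)) a * v l) ∈ W := by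
    intro v hv
    have := hW _ (hpow (m - 1) (by omega) v hv)
    convert this using 1
    ext l
    rw [petitMono_one_mul_petitMono_pred_mul hm hσ]
  have hprod : ∀ s : Finset (Fin m),
      (fun l : Fin m => (∏ j ∈ s, ((σ ^ (l : ℕ)) a - (σ ^ (j : ℕ)) a)) * y l) ∈ W := by
    intro s
    induction s using Finset.induction_on with
    | empty => simpa using hy
    | insert j s hj ih =>
      convert W.sub_mem (hdiag _ ih) (W.smul_mem ((σ ^ (j : ℕ)) a) ih) using 1
      ext l
      rw [Finset.prod_insert hj]
      simp only [Pi.sub_apply, Pi.smul_apply, smul_eq_mul]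
      ring
  obtain ⟨n, hn⟩ := Function.ne_iff.mp hy0
  have hsmul : ∀ (c : K) (i : ℕ), c ≠ 0 → petitMono m i c ∈ W → petitMono m i 1 ∈ W := by
    intro c i hc h
    convert W.smul_mem c⁻¹ h using 1
    ext l
    simp [petitMono, hc]
  have hn1 : petitMono m n 1 ∈ W := by
    refine hsmul ((∏ j ∈ Finset.univ.erase n, ((σ ^ (n : ℕ)) a - (σ ^ (j : ℕ)) a)) * y n) n ?_ ?_
    · refine mul_ne_zero (Finset.prod_ne_zero_iff.mpr fun j hj => sub_ne_zero.mpr ?_) hn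
      exact hinj n j (Finset.ne_of_mem_erase hj).symm
    · convert hprod (Finset.univ.erase n) using 1
      ext l
      unfold petitMono
      split_ifs with h
      · rw [Fin.ext h]
      · rw [Finset.prod_eq_zero (i := l) (by simpa [Fin.ext_iff] using h) (sub_self _), zero_mul]
  have h0 : petitMono m 0 1 ∈ W := by
    rcases Nat.eq_zero_or_pos (n : ℕ) with h | h
    · rwa [h] at hn1
    · have := hpow (m - n) (by omega) _ hn1
      rw [petitMono_mul_petitMono_of_le (by omega) n.2 (by omega),
        show m - n + n - m = 0 by omega] at this
      exact hsmul a 0 ha0 (by simpa using this)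
  rw [eq_top_iff]
  intro v _
  have hv : v = petitMul σ a m v (petitMono m 0 1) := (mul_petitMono_zero_one (by omega) v).symm
  rw [hv, petitMul_eq_sum_smul]
  exact W.sum_mem fun i _ => W.smul_mem _ (hpow i i.2 _ h0)

/-- A nonassociative cyclic algebra `(K/F,σ,a)` is a division algebra if `a` has trivial
stabilizer. -/
theorem eq_zero_or_eq_zero_of_petitMul_eq_zero (hm : 1 < m) (hσ : σ ^ m = 1)
    (ha : ∀ i, 0 < i → i < m → (σ ^ i) a ≠ a) {x y : Fin m → K} (h : petitMul σ a m x y = 0) :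
    x = 0 ∨ y = 0 := by
  classical
  by_contra! hxy
  obtain ⟨hx, hy⟩ := hxy
  set P : Fin m → Fin m → K := fun i => petitMul σ a m (petitMono m i 1) y with hP
  have hne : (Finset.univ.filter fun i => x i ≠ 0).Nonempty := by
    obtain ⟨i, hi⟩ := Function.ne_iff.mp hx
    exact ⟨i, by simpa using hi⟩
  obtain ⟨r, hr, hmax⟩ := Finset.exists_max_image _ id hne
  simp only [Finset.mem_filter, Finset.mem_univ, true_and, id] at hr hmax
  set W : Submodule K (Fin m → K) :=
    Submodule.span K ((Finset.Iio r).image P : Finset (Fin m → K)) with hWdef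
  have hmem : ∀ i < r, P i ∈ W := fun i hi =>
    Submodule.subset_span (by
      rw [Finset.mem_coe]
      exact Finset.mem_image_of_mem _ (Finset.mem_Iio.mpr hi))
  have hrW : P r ∈ W := by
    rw [petitMul_eq_sum_smul, ← Finset.add_sum_erase _ _ (Finset.mem_univ r)] at h
    have h1 : x r • P r = -∑ i ∈ Finset.univ.erase r, x i • P i := eq_neg_of_add_eq_zero_left h
    have h2 : P r = (x r)⁻¹ • (x r • P r) := by rw [smul_smul, inv_mul_cancel₀ hr, one_smul]
    rw [h2, h1]
    refine W.smul_mem _ (W.neg_mem (W.sum_mem fun i hi => ?_))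
    by_cases hxi : x i = 0
    · rw [hxi, zero_smul]; exact W.zero_mem
    · exact W.smul_mem _ (hmem i (lt_of_le_of_ne (hmax i hxi) (Finset.ne_of_mem_erase hi)))
  have hP0 : P ⟨0, by omega⟩ = y := petitMono_zero_one_mul (by omega) y
  have hyW : y ∈ W := by
    rw [← hP0]
    rcases Nat.eq_zero_or_pos (r : ℕ) with h0 | h0
    · have : r = ⟨0, by omega⟩ := Fin.ext h0
      rwa [← this]
    · exact hmem _ h0
  have hstep (i : Fin m) (hi : (i : ℕ) + 1 < m) :
      petitMul σ a m (petitMono m 1 1) (P i) = P ⟨i + 1, hi⟩ :=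
    petitMono_one_mul_petitMono_one_mul hi y
  clear_value P
  have hinv : ∀ v ∈ W, petitMul σ a m (petitMono m 1 1) v ∈ W := by
    intro v hv
    induction hv using Submodule.span_induction with
    | mem v hv =>
      obtain ⟨i, hi, rfl⟩ := Finset.mem_image.mp (Finset.mem_coe.mp hv)
      have hi : i < r := Finset.mem_Iio.mp hi
      rcases (Nat.succ_le_of_lt hi).lt_or_eq with h1 | h1
      · exact hstep i (by omega) ▸ hmem ⟨i + 1, by omega⟩ h1
      · rw [hstep i (by omega), show (⟨i + 1, by omega⟩ : Fin m) = r from Fin.ext h1]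
        exact hrW
    | zero => rw [petitMul_zero_right]; exact W.zero_mem
    | add u v _ _ hu hv => rw [petitMul_add_right]; exact W.add_mem hu hv
    | smul c v _ hv => rw [petitMono_one_mul_smul hm]; exact W.smul_mem _ hv
  have htop := eq_top_of_petitMono_one_mul_mem hm hσ ha W hinv hyW hy
  have hle : Module.finrank K W ≤ r := by
    exact (finrank_span_finset_le_card _).trans (Finset.card_image_le.trans (Fin.card_Iio r).le)
  rw [htop, finrank_top, Module.finrank_fin_fun] at hle
  omega

theorem petitMono_zero_mul (hm : 0 < m) (c : K) (y : Fin m → K) :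
    petitMul σ a m (petitMono m 0 c) y = c • y := by
  ext l
  simp [petitMono_mul_apply hm]

theorem petitMono_ne_zero {i : ℕ} (hi : i < m) {c : K} (hc : c ≠ 0) : petitMono m i c ≠ 0 :=
  fun h => hc (by simpa [petitMono] using congrFun h ⟨i, hi⟩)

theorem petitMono_injective {i : ℕ} (hi : i < m) :
    Function.Injective (petitMono m i : K → Fin m → K) :=
  fun c d h => by simpa [petitMono] using congrFun h ⟨i, hi⟩

/-- Twisting the coordinates by an automorphism and rescaling `t` is an isomorphism of Petit
algebras. -/
theorem petitIso_of_apply_eq_prod_mul {τ : K ≃ₐ[F] K} (hτ : Commute σ τ) {b k : K} (hk : k ≠ 0)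
    (h : τ a = (∏ j ∈ Finset.range m, (σ ^ j) k) * b) : PetitIso σ σ a b m := by
  set ν : ℕ → K := fun i => ∏ j ∈ Finset.range i, (σ ^ j) k with hν
  have hν0 (i : ℕ) : ν i ≠ 0 := Finset.prod_ne_zero_iff.mpr fun j _ =>
    (map_ne_zero (σ ^ j)).mpr hk
  have hνadd (i j : ℕ) : ν (i + j) = ν i * (σ ^ i) (ν j) := by
    simp only [hν, Finset.prod_range_add, map_prod, pow_add, AlgEquiv.mul_apply]
  have hcomm (i : ℕ) (z : K) : τ ((σ ^ i) z) = (σ ^ i) (τ z) := by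
    rw [← AlgEquiv.mul_apply, ← AlgEquiv.mul_apply, (hτ.pow_left i).eq]
  let e : (Fin m → K) ≃ₗ[F] (Fin m → K) :=
    { toFun := fun x l => τ (x l) * ν l
      invFun := fun x l => τ.symm (x l * (ν l)⁻¹)
      map_add' := fun x y => by ext l; simp [add_mul]
      map_smul' := fun c x => by ext l; simp
      left_inv := fun x => by ext l; simp [hν0]
      right_inv := fun x => by ext l; simp [hν0] }
  refine ⟨e, fun x y => ?_⟩
  ext l
  change τ (petitMul σ a m x y l) * ν l = _
  simp only [petitMul, map_add, map_sum, add_mul, Finset.sum_mul]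
  congr 1 <;> refine Finset.sum_congr rfl fun i _ => Finset.sum_congr rfl fun j _ => ?_
  · split_ifs with hij
    · change _ = τ (x i) * ν i * (σ ^ (i : ℕ)) (τ (y j) * ν j)
      rw [← hij, hνadd]
      simp only [map_mul, hcomm]
      ring
    · simp
  · split_ifs with hij
    · change _ = τ (x i) * ν i * (σ ^ (i : ℕ)) (τ (y j) * ν j) * _
      have h1 : ν i * (σ ^ (i : ℕ)) (ν j) = ν l * (σ ^ (l : ℕ)) (ν m) := by
        rw [← hνadd, ← hνadd, hij]
      have h2 : τ a = ν m * b := h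
      simp only [map_mul, hcomm, h2]
      linear_combination (-τ (x i) * (σ ^ (i : ℕ)) (τ (y j)) * (σ ^ (l : ℕ)) b) * h1
    · simp

variable {σ' : K ≃ₐ[F] K} {b : K}

/-- An isomorphism of nonassociative cyclic algebras restricts to an automorphism of the left
nucleus `K`. -/
theorem exists_algEquiv_of_petitIso [FiniteDimensional F K] (hm : 1 < m) (hb : σ' b ≠ b)
    (e : (Fin m → K) ≃ₗ[F] (Fin m → K))
    (he : ∀ x y, e (petitMul σ a m x y) = petitMul σ' b m (e x) (e y)) :
    ∃ τ : K ≃ₐ[F] K, ∀ c, e (petitMono m 0 c) = petitMono m 0 (τ c) := by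
  have hm0 : 0 < m := by omega
  have h1 : e (petitMono m 0 1) = petitMono m 0 1 := by
    obtain ⟨z, hz⟩ := e.surjective (petitMono m 0 1)
    have h := he (petitMono m 0 1) z
    rw [petitMono_zero_one_mul hm0, hz, mul_petitMono_zero_one hm0] at h
    exact h.symm
  have hnuc (c : K) : e (petitMono m 0 c) = petitMono m 0 (e (petitMono m 0 c) ⟨0, hm0⟩) := by
    ext l
    by_cases hl : (l : ℕ) = 0
    · have : l = ⟨0, hm0⟩ := Fin.ext hl
      simp [petitMono, this]
    · rw [petitMono, if_neg hl]
      refine apply_eq_zero_of_mem_left_nucleus hm hb (fun y z => ?_) l hl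
      rw [← e.apply_symm_apply y, ← e.apply_symm_apply z, ← he, ← he, ← he, ← he,
        petitMono_zero_mul hm0, petitMono_zero_mul hm0, petitMul_smul_left]
  have hadd (c d : K) : petitMono m 0 (c + d) = petitMono m 0 c + petitMono m 0 d := by
    ext l
    simp only [petitMono, Pi.add_apply]
    split_ifs <;> simp
  have hmul (c d : K) : e (petitMono m 0 (c * d)) =
      petitMono m 0 (e (petitMono m 0 c) ⟨0, hm0⟩ * e (petitMono m 0 d) ⟨0, hm0⟩) := by
    have h := petitMono_mul_petitMono_of_lt (σ := σ) (a := a) (i := 0) (j := 0) (by omega) c d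
    rw [pow_zero, AlgEquiv.one_apply] at h
    rw [← h, he, hnuc c, hnuc d, petitMono_mul_petitMono_of_lt (by omega)]
    simp [petitMono]
  have halg (r : F) : petitMono m 0 (algebraMap F K r) = r • petitMono m 0 1 := by
    ext l
    simp only [petitMono, Pi.smul_apply]
    split_ifs <;> simp [Algebra.algebraMap_eq_smul_one]
  let f : K →ₐ[F] K :=
    { toFun := fun c => e (petitMono m 0 c) ⟨0, hm0⟩
      map_one' := by simp [h1, petitMono]
      map_mul' := fun c d => by
        change e (petitMono m 0 (c * d)) ⟨0, hm0⟩ = _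
        rw [hmul]
        exact if_pos rfl
      map_zero' := by
        have : petitMono m 0 (0 : K) = 0 := by ext; simp [petitMono]
        simp [this]
      map_add' := fun c d => by rw [hadd, map_add, Pi.add_apply]
      commutes' := fun r => by
        rw [halg, map_smul, h1]
        simp [petitMono, Algebra.algebraMap_eq_smul_one] }
  exact ⟨AlgEquiv.ofBijective f (Algebra.IsAlgebraic.algHom_bijective f), hnuc⟩

/-- The generator `t` is mapped to a monomial by an isomorphism of nonassociative cyclic
algebras. -/
theorem exists_apply_petitMono_one_eq (hm : 1 < m)
    (hinj : ∀ i < m, ∀ j < m, σ' ^ i = σ' ^ j → i = j)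
    (e : (Fin m → K) ≃ₗ[F] (Fin m → K))
    (he : ∀ x y, e (petitMul σ a m x y) = petitMul σ' b m (e x) (e y))
    {τ : K ≃ₐ[F] K} (hστ : Commute σ τ) (hτ : ∀ c, e (petitMono m 0 c) = petitMono m 0 (τ c)) :
    ∃ i < m, ∃ k : K, k ≠ 0 ∧ σ' ^ i = σ ∧ e (petitMono m 1 1) = petitMono m i k := by
  have hm0 : 0 < m := by omega
  set u := e (petitMono m 1 1) with hu
  have hu0 : u ≠ 0 := e.map_ne_zero_iff.mpr (petitMono_ne_zero hm one_ne_zero)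
  have hl (c : K) (l : Fin m) : u l * (σ' ^ (l : ℕ)) (τ c) = τ (σ c) * u l := by
    have h : petitMul σ a m (petitMono m 1 1) (petitMono m 0 c) =
        petitMul σ a m (petitMono m 0 (σ c)) (petitMono m 1 1) := by
      rw [petitMono_mul_petitMono_of_lt (by omega), petitMono_mul_petitMono_of_lt (by omega)]
      simp
    have h2 := congrFun (congrArg e h) l
    rw [he, he, hτ, hτ, ← hu, mul_petitMono_apply hm0, dif_pos (Nat.zero_le _),
      petitMono_zero_mul hm0] at h2
    simpa using h2
  have hpow (l : Fin m) (h : u l ≠ 0) : σ' ^ (l : ℕ) = σ := by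
    ext c
    have h2 := hl (τ.symm c) l
    rw [← AlgEquiv.mul_apply τ σ, ← hστ.eq, AlgEquiv.mul_apply, AlgEquiv.apply_symm_apply,
      mul_comm] at h2
    exact mul_right_cancel₀ h h2
  obtain ⟨i, hi⟩ := Function.ne_iff.mp hu0
  refine ⟨i, i.2, u i, hi, hpow i hi, ?_⟩
  ext l
  unfold petitMono
  split_ifs with h
  · rw [Fin.ext h]
  · by_contra h0
    exact h (hinj l l.2 i i.2 ((hpow l h0).trans (hpow i hi).symm))

/-- An isomorphism of nonassociative cyclic algebras does not send `t` to a multiple of `t ^ i`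
with `1 < i`. -/
theorem apply_petitMono_one_ne_petitMono (hσ : σ' ^ m = 1)
    (hb : ∀ i, 0 < i → i < m → (σ' ^ i) b ≠ b)
    (e : (Fin m → K) ≃ₗ[F] (Fin m → K))
    (he : ∀ x y, e (petitMul σ a m x y) = petitMul σ' b m (e x) (e y))
    {i : ℕ} (hi1 : 1 < i) (him : i < m) {k : K} (hk : k ≠ 0) :
    e (petitMono m 1 1) ≠ petitMono m i k := by
  intro hu
  have hb0 : b ≠ 0 := fun h => hb 1 one_pos (by omega) (by simp [h])
  have hpow (j : ℕ) (hj : i * (j + 1) < m) :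
      ∃ k' : K, k' ≠ 0 ∧ e (petitMono m (j + 1) 1) = petitMono m (i * (j + 1)) k' := by
    induction j with
    | zero => exact ⟨k, hk, by simpa using hu⟩
    | succ j ih =>
      have hjm : i * (j + 1) + i < m := by linarith [mul_add i (j + 1) 1]
      obtain ⟨k', hk', h⟩ := ih (by omega)
      have hlt : 1 + (j + 1) < m := by nlinarith
      refine ⟨k * (σ' ^ i) k', mul_ne_zero hk ((map_ne_zero (σ' ^ i)).mpr hk'), ?_⟩
      have h1 := petitMono_mul_petitMono_of_lt (σ := σ) (a := a) hlt 1 1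
      rw [map_one, mul_one, add_comm 1 (j + 1)] at h1
      rw [← h1, he, hu, h, petitMono_mul_petitMono_of_lt (by omega),
        show i * (j + 1 + 1) = i + i * (j + 1) by ring]
  obtain ⟨j, hj, hj'⟩ : ∃ j, i * (j + 1) < m ∧ m ≤ i + i * (j + 1) := by
    have h1 : 0 < (m - 1) / i := Nat.div_pos (by omega) (by omega)
    have h2 := Nat.div_add_mod (m - 1) i
    have h3 := Nat.mod_lt (m - 1) (show 0 < i by omega)
    refine ⟨(m - 1) / i - 1, ?_, ?_⟩ <;> rw [Nat.sub_add_cancel h1] <;> omega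
  obtain ⟨k', hk', h⟩ := hpow j hj
  have hjm : 1 + (j + 1) < m := by nlinarith
  have hassoc : petitMul σ a m (petitMul σ a m (petitMono m 1 1) (petitMono m (j + 1) 1))
      (petitMono m 1 1) =
      petitMul σ a m (petitMono m 1 1) (petitMul σ a m (petitMono m (j + 1) 1)
        (petitMono m 1 1)) := by
    rw [petitMono_mul_petitMono_of_lt hjm,
      petitMono_mul_petitMono_of_lt (show j + 1 + 1 < m by omega)]
    simp only [map_one, mul_one, add_comm 1 (j + 1)]
    rcases (show j + 1 + 1 ≤ m - 1 by omega).lt_or_eq with h1 | h1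
    · rw [petitMono_mul_petitMono_of_lt (by omega), petitMono_mul_petitMono_of_lt (by omega)]
      simp [add_comm, add_left_comm]
    · rw [petitMono_mul_petitMono_of_le (by omega) (by omega) (by omega),
        petitMono_mul_petitMono_of_le (by omega) (by omega) (by omega)]
      simp only [map_one, mul_one, add_comm 1 (j + 1 + 1)]
  have h2 := congrArg e hassoc
  rw [he, he, he, he, hu, h, petitMono_mul_petitMono_of_le him hj hj',
    petitMono_mul_petitMono_of_le hj him (by omega)] at h2
  set c := i * (j + 1) with hc
  set s := i + c - m with hs
  have hs' : c + i - m = s := by omega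
  rw [hs'] at h2
  have hic (z : K) : (σ' ^ i) ((σ' ^ c) z) = (σ' ^ s) z := by
    rw [← AlgEquiv.mul_apply, ← pow_add, show i + c = s + m by omega, pow_add, hσ, mul_one]
  have h5 : k * (σ' ^ i) k' * (σ' ^ s) k ≠ 0 :=
    mul_ne_zero (mul_ne_zero hk ((map_ne_zero (σ' ^ i)).mpr hk')) ((map_ne_zero (σ' ^ s)).mpr hk)
  have hcancel : (σ' ^ i) ((σ' ^ s) b) = (σ' ^ s) b := by
    rcases lt_or_ge (s + i) m with h3 | h3
    · rw [petitMono_mul_petitMono_of_lt h3, petitMono_mul_petitMono_of_lt (by omega),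
        add_comm s i] at h2
      have h4 := petitMono_injective (by omega) h2
      simp only [map_mul, hic] at h4
      apply mul_left_cancel₀ h5
      linear_combination -h4
    · rw [petitMono_mul_petitMono_of_le (by omega) him h3,
        petitMono_mul_petitMono_of_le him (by omega) (by omega), add_comm s i] at h2
      have h4 := petitMono_injective (by omega) h2
      simp only [map_mul, hic] at h4
      apply mul_left_cancel₀ (mul_ne_zero h5 ((map_ne_zero (σ' ^ (i + s - m))).mpr hb0))
      linear_combination -h4
  rw [← AlgEquiv.mul_apply, ← pow_add, add_comm, pow_add, AlgEquiv.mul_apply] at hcancel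
  exact hb i (by omega) him ((σ' ^ s).injective hcancel)

theorem eq_prod_mul_of_apply_petitMono_one_eq (hm : 1 < m)
    (e : (Fin m → K) ≃ₗ[F] (Fin m → K))
    (he : ∀ x y, e (petitMul σ a m x y) = petitMul σ' b m (e x) (e y))
    {τ : K ≃ₐ[F] K} (hτ : ∀ c, e (petitMono m 0 c) = petitMono m 0 (τ c)) {k : K}
    (hu : e (petitMono m 1 1) = petitMono m 1 k) :
    τ a = (∏ j ∈ Finset.range m, (σ' ^ j) k) * b := by
  have hpow (j : ℕ) (hj : j < m) :
      e (petitMono m j 1) = petitMono m j (∏ j ∈ Finset.range j, (σ' ^ j) k) := by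
    induction j with
    | zero => simp [hτ]
    | succ j ih =>
      have h1 := petitMono_mul_petitMono_of_lt (σ := σ) (a := a) (show 1 + j < m by omega) 1 1
      rw [map_one, mul_one, add_comm 1 j] at h1
      rw [← h1, he, hu, ih (by omega),
        petitMono_mul_petitMono_of_lt (show 1 + j < m by omega), Finset.prod_range_succ', add_comm 1 j]
      simp only [map_prod, ← AlgEquiv.mul_apply, ← pow_add, add_comm 1, pow_zero,
        AlgEquiv.one_apply, mul_comm k]
  have h1 := petitMono_mul_petitMono_of_le (σ := σ) (a := a) (i := 1) (j := m - 1) hm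
    (by omega) (by omega) 1 1
  have h2 := congrArg e h1
  rw [he, hu, hpow (m - 1) (by omega),
    petitMono_mul_petitMono_of_le hm (by omega) (by omega), show 1 + (m - 1) - m = 0 by omega,
    hτ] at h2
  have h3 := petitMono_injective (by omega) h2
  have hm1 : m = m - 1 + 1 := by omega
  conv_rhs => rw [hm1]
  rw [Finset.prod_range_succ']
  simp only [map_prod, ← AlgEquiv.mul_apply, ← pow_add, add_comm 1, pow_zero,
    AlgEquiv.one_apply, mul_comm k, map_one, mul_one, one_mul] at h3 ⊢
  exact h3.symm

end Petit

section Cyclic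

variable {F K : Type*} [Field F] [Field K] [Algebra F K] [FiniteDimensional F K] [IsGalois F K]
  {m : ℕ}

theorem mem_range_algebraMap_of_prime (hm : m.Prime) (hcard : Nat.card (K ≃ₐ[F] K) = m)
    {τ : K ≃ₐ[F] K} (hτ : τ ≠ 1) {a : K} (ha : τ a = a) : a ∈ Set.range (algebraMap F K) := by
  have : Fact m.Prime := ⟨hm⟩
  rw [IsGalois.mem_range_algebraMap_iff_fixed]
  intro f
  have hf : f ∈ Subgroup.zpowers τ := mem_zpowers_of_prime_card hcard hτ
  have hle : Subgroup.zpowers τ ≤ MulAction.stabilizer (K ≃ₐ[F] K) a :=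
    (Subgroup.zpowers_le).mpr ha
  exact hle hf

theorem pow_apply_ne_of_notMem_range (hm : m.Prime) (hcard : Nat.card (K ≃ₐ[F] K) = m)
    {σ : K ≃ₐ[F] K} (hσ : ∀ τ, τ ∈ Subgroup.zpowers σ) {a : K}
    (ha : a ∉ Set.range (algebraMap F K)) (i : ℕ) (hi0 : 0 < i) (hi : i < m) :
    (σ ^ i) a ≠ a := by
  intro h
  refine ha (mem_range_algebraMap_of_prime hm hcard (fun h1 => ?_) h)
  have h2 := orderOf_dvd_of_pow_eq_one h1
  rw [orderOf_eq_card_of_forall_mem_zpowers hσ, hcard] at h2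
  exact absurd (Nat.le_of_dvd hi0 h2) (by omega)

theorem prod_range_pow_apply_eq_algebraMap_norm (hcard : Nat.card (K ≃ₐ[F] K) = m)
    {σ : K ≃ₐ[F] K} (hσ : ∀ τ, τ ∈ Subgroup.zpowers σ) (k : K) :
    ∏ j ∈ Finset.range m, (σ ^ j) k = algebraMap F K (Algebra.norm F k) := by
  classical
  rw [Algebra.norm_eq_prod_automorphisms, ← IsCyclic.image_range_card hσ, hcard,
    Finset.prod_image]
  intro i hi j hj h
  have ho : orderOf σ = m := by rw [orderOf_eq_card_of_forall_mem_zpowers hσ, hcard]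
  exact pow_injOn_Iio_orderOf (by simpa [ho] using hi) (by simpa [ho] using hj) h

theorem petitIso_iff [Finite K] (hm : m.Prime) (hcard : Nat.card (K ≃ₐ[F] K) = m)
    {σ σ' : K ≃ₐ[F] K} (hσ : ∀ τ, τ ∈ Subgroup.zpowers σ) (hσ' : ∀ τ, τ ∈ Subgroup.zpowers σ')
    {a b : K} (hb : b ∉ Set.range (algebraMap F K)) :
    PetitIso σ σ' a b m ↔ σ = σ' ∧ ∃ (c : Fˣ) (τ : K ≃ₐ[F] K), (c : F) • τ a = b := by
  have hcomm (τ : K ≃ₐ[F] K) : Commute σ τ := by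
    obtain ⟨n, rfl⟩ := Subgroup.mem_zpowers_iff.mp (hσ τ)
    exact (Commute.refl σ).zpow_right n
  constructor
  · rintro ⟨e, he⟩
    have hb' := pow_apply_ne_of_notMem_range hm hcard hσ' hb
    have ho : orderOf σ' = m := by rw [orderOf_eq_card_of_forall_mem_zpowers hσ', hcard]
    obtain ⟨τ, hτ⟩ := exists_algEquiv_of_petitIso hm.one_lt
      (by simpa using hb' 1 one_pos hm.one_lt) e he
    obtain ⟨i, hi, k, hk, hσi, hu⟩ := exists_apply_petitMono_one_eq hm.one_lt
      (fun i hi j hj h => pow_injOn_Iio_orderOf (by simpa [ho] using hi) (by simpa [ho] using hj) h)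
      e he (hcomm τ) hτ
    have hi1 : i = 1 := by
      rcases lt_trichotomy i 1 with h | h | h
      · have h0 : σ = 1 := by rw [← hσi, Nat.lt_one_iff.mp h, pow_zero]
        have h1 := orderOf_eq_card_of_forall_mem_zpowers hσ
        rw [h0, orderOf_one, hcard] at h1
        exact absurd h1.symm hm.ne_one
      · exact h
      · exact absurd hu (apply_petitMono_one_ne_petitMono (by rw [← ho, pow_orderOf_eq_one])
          hb' e he h hi hk)
    subst hi1
    have hn : Algebra.norm F k ≠ 0 := Algebra.norm_ne_zero_iff.mpr hk
    refine ⟨by simpa using hσi.symm, (Units.mk0 _ hn)⁻¹, τ, ?_⟩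
    rw [eq_prod_mul_of_apply_petitMono_one_eq hm.one_lt e he hτ hu,
      prod_range_pow_apply_eq_algebraMap_norm hcard hσ', ← Algebra.smul_def,
      Units.val_inv_eq_inv_val, Units.val_mk0, inv_smul_smul₀ hn]
  · rintro ⟨rfl, c, τ, rfl⟩
    have : Finite F := Finite.of_injective _ (algebraMap F K).injective
    obtain ⟨k, hk⟩ := FiniteField.norm_surjective F K (c⁻¹ : Fˣ)
    refine petitIso_of_apply_eq_prod_mul (hcomm τ) (k := k) ?_ ?_
    · rintro rfl
      rw [Algebra.norm_zero] at hk
      exact (c⁻¹).ne_zero hk.symm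
    · rw [prod_range_pow_apply_eq_algebraMap_norm hcard hσ, hk, ← Algebra.smul_def,
        ← Units.smul_def, ← Units.smul_def, inv_smul_smul]

/-- The action of `Fˣ × Gal(K/F)` on `K ∖ F` by scaling and by automorphisms. -/
abbrev unitsProdGalAction (F K : Type*) [Field F] [Field K] [Algebra F K] :
    MulAction (Fˣ × (K ≃ₐ[F] K)) {a : K // a ∉ Set.range (algebraMap F K)} where
  smul g a := ⟨(g.1 : F) • g.2 a, by
    rintro ⟨r, hr⟩
    refine a.2 ⟨(g.1 : F)⁻¹ * r, g.2.injective ?_⟩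
    rw [AlgEquiv.commutes, map_mul, hr, ← Algebra.smul_def, inv_smul_smul₀ g.1.ne_zero]⟩
  one_smul a := Subtype.ext (by
    change ((1 : Fˣ) : F) • (a : K) = a
    simp)
  mul_smul g h a := Subtype.ext (by
    change ((g.1 * h.1 : Fˣ) : F) • (g.2 * h.2) (a : K) = (g.1 : F) • g.2 ((h.1 : F) • h.2 a)
    rw [map_smul, smul_smul, Units.val_mul, AlgEquiv.mul_apply])

theorem eq_one_of_smul_apply_eq [Finite F] (hm : m.Prime) (hcard : Nat.card (K ≃ₐ[F] K) = m)
    (hnd : ¬ m ∣ Nat.card F - 1) {c : Fˣ} {τ : K ≃ₐ[F] K} {a : K}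
    (ha : a ∉ Set.range (algebraMap F K)) (h : (c : F) • τ a = a) : c = 1 ∧ τ = 1 := by
  have hpow (n : ℕ) : (c ^ n : Fˣ) • (τ ^ n) a = a := by
    induction n with
    | zero => simp
    | succ n ih =>
      rw [pow_succ', pow_succ', AlgEquiv.mul_apply, mul_smul, Units.smul_def c]
      conv_rhs => rw [← h, ← ih]
      simp only [Units.smul_def, map_smul]
  have ha0 : a ≠ 0 := by
    rintro rfl
    exact ha ⟨0, map_zero _⟩
  have hτm : τ ^ m = 1 := by rw [← hcard, pow_card_eq_one']
  have hcm : c ^ m = 1 := by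
    have h1 := hpow m
    rw [hτm, AlgEquiv.one_apply, Units.smul_def] at h1
    exact Units.ext (smul_left_injective F ha0 (by simpa using h1))
  have hcq : c ^ (Nat.card F - 1) = 1 := by rw [← Nat.card_units, pow_card_eq_one']
  have hc : c = 1 := by
    rw [← orderOf_eq_one_iff, ← Nat.dvd_one, ← (hm.coprime_iff_not_dvd.mpr hnd).gcd_eq_one]
    exact Nat.dvd_gcd (orderOf_dvd_of_pow_eq_one hcm) (orderOf_dvd_of_pow_eq_one hcq)
  refine ⟨hc, ?_⟩
  by_contra hτ
  exact ha (mem_range_algebraMap_of_prime hm hcard hτ (by simpa [hc] using h))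

end Cyclic

theorem card_notMem_range_algebraMap {F K : Type*} [Field F] [Field K] [Algebra F K]
    [FiniteDimensional F K] [Finite K] :
    Nat.card {a : K // a ∉ Set.range (algebraMap F K)} =
      Nat.card F ^ Module.finrank F K - Nat.card F := by
  have h := Set.ncard_compl (Set.range (algebraMap F K))
  rw [← Module.natCard_eq_pow_finrank (K := F) (V := K)]
  rw [← Nat.card_coe_set_eq (Set.range _), Nat.card_range_of_injective (algebraMap F K).injective]
    at h
  exact h

theorem card_generators_of_prime {G : Type*} [Group G] [Finite G] (hG : (Nat.card G).Prime) :
    Nat.card {g : G // ∀ h, h ∈ Subgroup.zpowers g} = Nat.card G - 1 := by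
  have : Fact (Nat.card G).Prime := ⟨hG⟩
  have hset : {g : G | ∀ h, h ∈ Subgroup.zpowers g} = {1}ᶜ := by
    ext g
    constructor
    · rintro hg rfl
      have h1 := orderOf_eq_card_of_forall_mem_zpowers hg
      rw [orderOf_one] at h1
      exact hG.ne_one h1.symm
    · exact fun hg h => mem_zpowers_of_prime_card rfl hg
  have h := Set.ncard_compl ({1} : Set G)
  rw [Set.ncard_singleton, ← hset] at h
  exact h

/-- Let `q` be a prime power and `m` a prime not dividing
`q - 1`. Each nonassociative cyclic algebra `(𝔽_{q^m}/𝔽_q, σ, a)` (with `σ` a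
generator of the Galois group and `a ∈ 𝔽_{q^m} ∖ 𝔽_q`) is a division algebra,
and the number of classes of pairs `(σ, a)` up to isomorphism of the associated
algebras equals `(m-1)(q^m - q)/(m(q-1))`, this number being an integer. -/
theorem stmt_13 {F K : Type*} [Field F] [Fintype F] [Field K] [Algebra F K]
    [IsGalois F K]
    (q m : ℕ) (hq : IsPrimePow q) (hcard : Fintype.card F = q)
    (hm : Nat.Prime m) (hnd : ¬ m ∣ q - 1)
    (hdeg : Module.finrank F K = m) :
    (∀ σ : K ≃ₐ[F] K, (∀ τ : K ≃ₐ[F] K, τ ∈ Subgroup.zpowers σ) →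
      ∀ a : K, a ∉ Set.range (algebraMap F K) →
      ∀ x y : Fin m → K, petitMul σ a m x y = 0 → x = 0 ∨ y = 0) ∧
    m * (q - 1) ∣ (m - 1) * (q ^ m - q) ∧
    ∃ c : {p : (K ≃ₐ[F] K) × K //
        (∀ τ : K ≃ₐ[F] K, τ ∈ Subgroup.zpowers p.1) ∧
        p.2 ∉ Set.range (algebraMap F K)} →
        Fin ((m - 1) * (q ^ m - q) / (m * (q - 1))),
      Function.Surjective c ∧
      ∀ p p', c p = c p' ↔ PetitIso p.1.1 p'.1.1 p.1.2 p'.1.2 m := by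
  have : FiniteDimensional F K := Module.finite_of_finrank_pos (hdeg ▸ hm.pos)
  have : Finite K := Module.finite_of_finite F
  have hG : Nat.card (K ≃ₐ[F] K) = m := by rw [IsGalois.card_aut_eq_finrank, hdeg]
  have hF : Nat.card F = q := by rw [Nat.card_eq_fintype_card, hcard]
  have hq1 : 0 < q - 1 := by have := hq.one_lt; omega
  let := unitsProdGalAction F K
  let Q := MulAction.orbitRel.Quotient (Fˣ × (K ≃ₐ[F] K))
    {a : K // a ∉ Set.range (algebraMap F K)}
  have hfree (a : {a : K // a ∉ Set.range (algebraMap F K)}) :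
      MulAction.stabilizer (Fˣ × (K ≃ₐ[F] K)) a = ⊥ := by
    rw [eq_bot_iff]
    intro g hg
    have h := eq_one_of_smul_apply_eq hm hG (hF ▸ hnd) a.2 (congrArg Subtype.val hg)
    exact Prod.ext h.1 h.2
  have hX : q ^ m - q = Nat.card Q * (m * (q - 1)) := by
    have h := Nat.card_congr (MulAction.selfEquivOrbitsQuotientProd hfree)
    rw [card_notMem_range_algebraMap, Nat.card_prod, Nat.card_prod, Nat.card_units, hG, hF, hdeg]
      at h
    rw [h, mul_comm m]
  have hcount : (m - 1) * (q ^ m - q) = (m - 1) * Nat.card Q * (m * (q - 1)) := by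
    rw [hX, mul_assoc]
  refine ⟨fun σ hσ a ha x y h => ?_, ⟨_, hcount.trans (mul_comm _ _)⟩, ?_⟩
  · exact eq_zero_or_eq_zero_of_petitMul_eq_zero hm.one_lt (by rw [← hG, pow_card_eq_one'])
      (pow_apply_ne_of_notMem_range hm hG hσ ha) h
  · have hcard' : Nat.card ({σ : K ≃ₐ[F] K // ∀ τ, τ ∈ Subgroup.zpowers σ} × Q) =
        (m - 1) * (q ^ m - q) / (m * (q - 1)) := by
      rw [hcount, Nat.mul_div_cancel _ (Nat.mul_pos hm.pos hq1), Nat.card_prod,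
        card_generators_of_prime (hG ▸ hm), hG]
    let E := Finite.equivFinOfCardEq hcard'
    refine ⟨fun p => E (⟨p.1.1, p.2.1⟩, Quotient.mk'' ⟨p.1.2, p.2.2⟩), fun n => ?_,
      fun p p' => ?_⟩
    · obtain ⟨⟨σ, x⟩, hx⟩ := E.surjective n
      induction x using Quotient.inductionOn' with
      | h a => exact ⟨⟨(σ, a), σ.2, a.2⟩, hx⟩
    · rw [E.injective.eq_iff, Prod.mk.injEq, Subtype.mk.injEq,
        petitIso_iff hm hG p.2.1 p'.2.1 p'.2.2, eq_comm (a := (Quotient.mk'' _ : Q)), Quotient.eq'',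
        MulAction.orbitRel_apply]
      refine and_congr_right fun _ => ⟨?_, ?_⟩
      · rintro ⟨g, hg⟩
        exact ⟨g.1, g.2, congrArg Subtype.val hg⟩
      · rintro ⟨c, τ, h⟩
        exact ⟨(c, τ), Subtype.ext h⟩
end

section
/- Let q be a prime power and m a prime dividing q−1. Consider the set of pairs (σ, a) where σ is a generator of Gal(𝔽_{q^m}/𝔽_q) and a ∈ 𝔽_{q^m} ∖ 𝔽_q, and declare (σ₁, a₁) and (σ₂, a₂) equivalent if the nonassociative cyclic algebras (𝔽_{q^m}/𝔽_q, σ₁, a₁) and (𝔽_{q^m}/𝔽_q, σ₂, a₂) are isomorphic as 𝔽_q-algebras. Then each such algebra is a division algebra (a semifield of order q^{m²}), and the number of equivalence classes equals (m−1)·((m−1) + (q^m − q − (q−1)(m−1))/(m(q−1))) (the inner rational number being an integer). -/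
namespace Petit

variable {F K : Type*} [Field F] [Field K] [Algebra F K]

/-- The monomial `x t^i` in the coordinates used by `petitMul`. -/
def mono (m i : ℕ) (x : K) : Fin m → K := fun l => if (l : ℕ) = i then x else 0

theorem eq_sum_mono {m : ℕ} (y : Fin m → K) : y = ∑ j : Fin m, mono m j (y j) := by
  ext l
  simp [mono, Fin.val_inj]

theorem mono_ne_zero {m i : ℕ} (hi : i < m) {x : K} (hx : x ≠ 0) : mono m i x ≠ 0 := by
  intro h
  exact hx (by simpa [mono] using congrFun h ⟨i, hi⟩)

theorem mono_injective {m i : ℕ} (hi : i < m) {x y : K} (h : mono m i x = mono m i y) :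
    x = y := by
  simpa [mono] using congrFun h ⟨i, hi⟩

theorem smul_mono (m i : ℕ) (c x : K) : c • mono m i x = mono m i (c * x) := by
  ext l
  simp [mono]

variable (σ : K ≃ₐ[F] K) (a : K) (m : ℕ)

theorem petitMul_add (x y z : Fin m → K) :
    petitMul σ a m x (y + z) = petitMul σ a m x y + petitMul σ a m x z := by
  ext l
  simp only [petitMul, Pi.add_apply, map_add, mul_add, add_mul]
  have h (p : Prop) [Decidable p] (u v : K) :
      (if p then u + v else 0) = (if p then u else 0) + (if p then v else 0) := by
    split_ifs <;> simp
  simp only [h, Finset.sum_add_distrib]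
  ring

theorem add_petitMul (x y z : Fin m → K) :
    petitMul σ a m (x + y) z = petitMul σ a m x z + petitMul σ a m y z := by
  ext l
  simp only [petitMul, Pi.add_apply, add_mul]
  have h (p : Prop) [Decidable p] (u v : K) :
      (if p then u + v else 0) = (if p then u else 0) + (if p then v else 0) := by
    split_ifs <;> simp
  simp only [h, Finset.sum_add_distrib]
  ring

theorem smul_petitMul (c : K) (x y : Fin m → K) :
    petitMul σ a m (c • x) y = c • petitMul σ a m x y := by
  ext l
  simp only [petitMul, Pi.smul_apply, smul_eq_mul, mul_add, Finset.mul_sum, mul_ite, mul_zero,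
    mul_assoc]

/-- Left multiplication in a Petit algebra as an additive map. -/
noncomputable def mulLeft (x : Fin m → K) : (Fin m → K) →+ (Fin m → K) :=
  AddMonoidHom.mk' (petitMul σ a m x) (petitMul_add σ a m x)

/-- Right multiplication in a Petit algebra as an additive map. -/
noncomputable def mulRight (y : Fin m → K) : (Fin m → K) →+ (Fin m → K) :=
  AddMonoidHom.mk' (fun x => petitMul σ a m x y) fun x x' => add_petitMul σ a m x x' y

theorem addMonoidHom_ext_mono {M : Type*} [AddCommMonoid M] {m : ℕ} {f g : (Fin m → K) →+ M}
    (h : ∀ i < m, ∀ x, f (mono m i x) = g (mono m i x)) : f = g := by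
  refine DFunLike.ext _ _ fun y => ?_
  rw [eq_sum_mono y, map_sum, map_sum]
  exact Finset.sum_congr rfl fun i _ => h i i.2 _

variable {m}

theorem petitMul_mono {i j : ℕ} (hi : i < m) (hj : j < m) (x y : K) :
    petitMul σ a m (mono m i x) (mono m j y) =
      if i + j < m then mono m (i + j) (x * (σ ^ i) y)
      else mono m (i + j - m) (x * (σ ^ i) y * (σ ^ (i + j - m)) a) := by
  ext l
  have hs (p : ℕ → ℕ → Prop) [∀ u v, Decidable (p u v)] (c : K) :
      (∑ u : Fin m, ∑ v : Fin m, if p u v then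
        mono m i x u * (σ ^ (u : ℕ)) (mono m j y v) * c else 0) =
      if p i j then x * (σ ^ i) y * c else 0 := by
    rw [Finset.sum_eq_single ⟨i, hi⟩, Finset.sum_eq_single ⟨j, hj⟩]
    · simp [mono]
    · intro v _ hv
      have : (v : ℕ) ≠ j := fun h => hv (Fin.ext h)
      simp [mono, this]
    · simp
    · intro u _ hu
      have : (u : ℕ) ≠ i := fun h => hu (Fin.ext h)
      simp [mono, this]
    · simp
  have h1 := hs (fun u v => u + v = (l : ℕ)) 1
  have h2 := hs (fun u v => u + v = (l : ℕ) + m) ((σ ^ (l : ℕ)) a)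
  simp only [mul_one] at h1
  simp only [petitMul]
  rw [h1, h2]
  have hl := l.2
  by_cases hij : i + j < m
  · have : ¬ (i + j = (l : ℕ) + m) := by omega
    simp [hij, this, mono, eq_comm]
  · have : ¬ (i + j = (l : ℕ)) := by omega
    simp only [this, hij, if_false, zero_add, mono]
    by_cases h : i + j = (l : ℕ) + m
    · have h' : (l : ℕ) = i + j - m := by omega
      rw [if_pos h, if_pos h', h']
    · have h' : ¬ (l : ℕ) = i + j - m := by omega
      rw [if_neg h, if_neg h']

theorem petitMul_mono_of_lt {i j : ℕ} (h : i + j < m) (x y : K) :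
    petitMul σ a m (mono m i x) (mono m j y) = mono m (i + j) (x * (σ ^ i) y) := by
  rw [petitMul_mono σ a (by omega) (by omega), if_pos h]

theorem petitMul_mono_of_le {i j : ℕ} (hi : i < m) (hj : j < m) (h : m ≤ i + j) (x y : K) :
    petitMul σ a m (mono m i x) (mono m j y) =
      mono m (i + j - m) (x * (σ ^ i) y * (σ ^ (i + j - m)) a) := by
  rw [petitMul_mono σ a hi hj, if_neg (by omega)]

variable {σ}

theorem pow_sub_apply (hσ : σ ^ m = 1) {n : ℕ} (h : m ≤ n) (x : K) :
    (σ ^ (n - m)) x = (σ ^ n) x := by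
  obtain ⟨d, rfl⟩ := Nat.exists_eq_add_of_le h
  simp [pow_add, hσ]

theorem pow_apply_pow_apply (i j : ℕ) (x : K) : (σ ^ i) ((σ ^ j) x) = (σ ^ (i + j)) x := by
  rw [pow_add, AlgEquiv.mul_apply]

theorem petitMul_assoc_mono (hσ : σ ^ m = 1) {i j k : ℕ} (hi : i < m) (hj : j < m) (hk : k < m)
    (h : i + j < m ∨ k = 0) (x y z : K) :
    petitMul σ a m (petitMul σ a m (mono m i x) (mono m j y)) (mono m k z) =
      petitMul σ a m (mono m i x) (petitMul σ a m (mono m j y) (mono m k z)) := by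
  by_cases hij : i + j < m
  · rw [petitMul_mono_of_lt σ a hij]
    by_cases hjk : j + k < m
    · rw [petitMul_mono_of_lt σ a hjk, petitMul_mono σ a hij hk, petitMul_mono σ a hi hjk]
      simp only [map_mul, pow_apply_pow_apply, add_assoc, mul_assoc]
    · have hjk' : m ≤ j + k := by omega
      have e1 : i + (j + k - m) = i + j + k - m := by omega
      rw [petitMul_mono_of_le σ a hj hk hjk', petitMul_mono_of_le σ a hij hk (by omega),
        petitMul_mono_of_lt σ a (by omega)]
      simp only [map_mul, pow_apply_pow_apply, mul_assoc, e1]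
  · obtain rfl : k = 0 := by omega
    have hij' : m ≤ i + j := by omega
    rw [petitMul_mono_of_le σ a hi hj hij', petitMul_mono_of_lt σ a (by omega),
      petitMul_mono_of_lt σ a (by omega), add_zero, add_zero,
      petitMul_mono_of_le σ a hi hj hij']
    simp only [map_mul, pow_apply_pow_apply, pow_sub_apply hσ hij']
    congr 1
    ring

theorem mono_petitMul_assoc (hσ : σ ^ m = 1) {i j : ℕ} (h : i + j < m) (x y : K)
    (z : Fin m → K) :
    petitMul σ a m (petitMul σ a m (mono m i x) (mono m j y)) z =
      petitMul σ a m (mono m i x) (petitMul σ a m (mono m j y) z) := by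
  have : mulLeft σ a m (petitMul σ a m (mono m i x) (mono m j y)) =
      (mulLeft σ a m (mono m i x)).comp (mulLeft σ a m (mono m j y)) :=
    addMonoidHom_ext_mono fun k hk z =>
      petitMul_assoc_mono a hσ (by omega) (by omega) hk (Or.inl h) x y z
  exact DFunLike.congr_fun this z

theorem petitMul_mono_zero_assoc (hσ : σ ^ m = 1) (x y : Fin m → K) (z : K) :
    petitMul σ a m (petitMul σ a m x y) (mono m 0 z) =
      petitMul σ a m x (petitMul σ a m y (mono m 0 z)) := by
  have h1 (i : ℕ) (hi : i < m) (x : K) :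
      (mulRight σ a m (mono m 0 z)).comp (mulLeft σ a m (mono m i x)) =
        (mulLeft σ a m (mono m i x)).comp (mulRight σ a m (mono m 0 z)) :=
    addMonoidHom_ext_mono fun j hj y =>
      petitMul_assoc_mono a hσ hi hj (by omega) (Or.inr rfl) x y z
  have h2 : (mulRight σ a m (mono m 0 z)).comp (mulRight σ a m y) =
      mulRight σ a m (petitMul σ a m y (mono m 0 z)) :=
    addMonoidHom_ext_mono fun i hi x => DFunLike.congr_fun (h1 i hi x) y
  exact DFunLike.congr_fun h2 x

theorem mono_zero_petitMul (c : K) (y : Fin m → K) :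
    petitMul σ a m (mono m 0 c) y = c • y := by
  have : mulLeft σ a m (mono m 0 c) = DistribSMul.toAddMonoidHom (Fin m → K) c :=
    addMonoidHom_ext_mono fun i hi x => by
      change petitMul σ a m (mono m 0 c) (mono m i x) = c • mono m i x
      rw [petitMul_mono_of_lt σ a (by omega), smul_mono]
      simp
  exact DFunLike.congr_fun this y

theorem petitMul_mono_zero (y : Fin m → K) (c : K) :
    petitMul σ a m y (mono m 0 c) = fun l : Fin m => y l * (σ ^ (l : ℕ)) c := by
  have : mulRight σ a m (mono m 0 c) =
      AddMonoidHom.mk' (fun (y : Fin m → K) (l : Fin m) => y l * (σ ^ (l : ℕ)) c)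
        (fun y z => by ext l; simp [add_mul]) :=
    addMonoidHom_ext_mono fun i hi x => by
      change petitMul σ a m (mono m i x) (mono m 0 c) =
        fun l : Fin m => mono m i x l * (σ ^ (l : ℕ)) c
      rw [petitMul_mono_of_lt σ a (by omega)]
      ext l
      by_cases h : (l : ℕ) = i <;> simp [mono, h]
  exact DFunLike.congr_fun this y

theorem mono_one_petitMul_smul (hσ : σ ^ m = 1) (hm : 1 < m) (c : K) (y : Fin m → K) :
    petitMul σ a m (mono m 1 1) (c • y) = σ c • petitMul σ a m (mono m 1 1) y := by
  rw [← mono_zero_petitMul (σ := σ) a c y, ← mono_petitMul_assoc a hσ (by omega),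
    petitMul_mono_of_lt σ a (by omega), ← smul_petitMul, smul_mono]
  simp

theorem mono_one_petitMul_mono_pred (hσ : σ ^ m = 1) (hm : 1 < m) (z : Fin m → K) :
    petitMul σ a m (mono m 1 1) (petitMul σ a m (mono m (m - 1) 1) z) =
      fun l : Fin m => z l * (σ ^ (l : ℕ)) a := by
  have : (mulLeft σ a m (mono m 1 1)).comp (mulLeft σ a m (mono m (m - 1) 1)) =
      AddMonoidHom.mk' (fun (y : Fin m → K) (l : Fin m) => y l * (σ ^ (l : ℕ)) a)
        (fun y z => by ext l; simp [add_mul]) :=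
    addMonoidHom_ext_mono fun i hi x => by
      change petitMul σ a m (mono m 1 1) (petitMul σ a m (mono m (m - 1) 1) (mono m i x)) =
        fun l : Fin m => mono m i x l * (σ ^ (l : ℕ)) a
      have hm' : 1 + (m - 1) = m := by omega
      have key : petitMul σ a m (mono m 1 1)
          (petitMul σ a m (mono m (m - 1) 1) (mono m i x)) =
          mono m i (x * (σ ^ i) a) := by
        rcases Nat.eq_zero_or_pos i with rfl | hi0
        · rw [petitMul_mono_of_lt σ a (by omega),
            petitMul_mono_of_le σ a (by omega) (by omega) (by omega)]
          simp only [one_mul, pow_apply_pow_apply, add_zero, hm', hσ, Nat.sub_self]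
          simp
        · have e1 : m - 1 + i - m = i - 1 := by omega
          have e2 : 1 + (i - 1) = i := by omega
          rw [petitMul_mono_of_le σ a (by omega) hi (by omega), e1,
            petitMul_mono_of_lt σ a (by omega)]
          simp only [one_mul, map_mul, pow_apply_pow_apply, hm', hσ, e2]
          simp
      rw [key]
      ext l
      by_cases h : (l : ℕ) = i <;> simp [mono, h]
  exact DFunLike.congr_fun this z


section Galois

variable [FiniteDimensional F K] [IsGalois F K]

theorem pow_finrank_eq_one (τ : K ≃ₐ[F] K) : τ ^ Module.finrank F K = 1 := by
  rw [← IsGalois.card_aut_eq_finrank F K]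
  exact pow_card_eq_one'

theorem eq_one_of_apply_eq (hp : (Module.finrank F K).Prime) {a : K}
    (ha : a ∉ Set.range (algebraMap F K)) {τ : K ≃ₐ[F] K} (h : τ a = a) : τ = 1 := by
  by_contra hτ
  refine ha ((IsGalois.mem_range_algebraMap_iff_fixed a).2 fun ρ => ?_)
  have : Fact (Module.finrank F K).Prime := ⟨hp⟩
  obtain ⟨n, rfl⟩ := Subgroup.mem_zpowers_iff.1
    (mem_zpowers_of_prime_card (IsGalois.card_aut_eq_finrank F K) hτ : ρ ∈ Subgroup.zpowers τ)
  have hs : τ ∈ MulAction.stabilizer (K ≃ₐ[F] K) a := h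
  exact Subgroup.zpow_mem _ hs n

theorem orderOf_of_generates {σ : K ≃ₐ[F] K} (hσ : ∀ τ, τ ∈ Subgroup.zpowers σ) :
    orderOf σ = Module.finrank F K := by
  rw [orderOf_eq_card_of_forall_mem_zpowers hσ, IsGalois.card_aut_eq_finrank]

theorem pow_injOn {σ : K ≃ₐ[F] K} (hσ : ∀ τ, τ ∈ Subgroup.zpowers σ) {i j : ℕ}
    (hi : i < Module.finrank F K) (hj : j < Module.finrank F K) (h : σ ^ i = σ ^ j) : i = j := by
  rw [← orderOf_of_generates hσ] at hi hj
  exact pow_injOn_Iio_orderOf hi hj h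

theorem exists_pow_eq {σ : K ≃ₐ[F] K} (hσ : ∀ τ, τ ∈ Subgroup.zpowers σ) (τ : K ≃ₐ[F] K) :
    ∃ i < Module.finrank F K, σ ^ i = τ := by
  have h := (mem_powers_iff_mem_zpowers).2 (hσ τ)
  obtain ⟨n, rfl⟩ := h
  refine ⟨n % orderOf σ, ?_, pow_mod_orderOf σ n⟩
  rw [← orderOf_of_generates hσ]
  exact Nat.mod_lt _ (orderOf_pos σ)

theorem mul_comm_of_generates {σ : K ≃ₐ[F] K} (hσ : ∀ τ, τ ∈ Subgroup.zpowers σ)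
    (τ ρ : K ≃ₐ[F] K) : τ * ρ = ρ * τ := by
  obtain ⟨i, -, rfl⟩ := exists_pow_eq hσ τ
  obtain ⟨j, -, rfl⟩ := exists_pow_eq hσ ρ
  rw [← pow_add, ← pow_add, add_comm]

end Galois

/-- A subspace of `K ^ m` stable under a diagonal map with distinct entries contains the
coordinate projections of its elements. -/
theorem mono_mem_of_diagonal_stable {m : ℕ} {W : Submodule K (Fin m → K)} {d : Fin m → K}
    (hd : Function.Injective d) (hW : ∀ w ∈ W, (fun l => w l * d l) ∈ W) {w : Fin m → K}
    (hw : w ∈ W) (l : Fin m) : mono m l (w l) ∈ W := by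
  have key (s : Finset (Fin m)) : (fun k => (∏ j ∈ s, (d k - d j)) * w k) ∈ W := by
    induction s using Finset.induction_on with
    | empty => simpa using hw
    | insert j s hj ih =>
      convert W.sub_mem (hW _ ih) (W.smul_mem (d j) ih) using 1
      ext k
      simp only [Finset.prod_insert hj, Pi.sub_apply, Pi.smul_apply, smul_eq_mul]
      ring
  have h0 : (∏ j ∈ Finset.univ.erase l, (d l - d j)) ≠ 0 := by
    refine Finset.prod_ne_zero_iff.2 fun j hj => sub_ne_zero.2 fun h => ?_
    exact (Finset.mem_erase.1 hj).1 (hd h).symm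
  convert W.smul_mem (∏ j ∈ Finset.univ.erase l, (d l - d j))⁻¹
    (key (Finset.univ.erase l)) using 1
  ext k
  simp only [mono, Pi.smul_apply, smul_eq_mul, Fin.val_inj]
  split_ifs with hk
  · subst hk
    rw [inv_mul_cancel_left₀ h0]
  · rw [Finset.prod_eq_zero (f := fun j => d k - d j)
      (Finset.mem_erase.2 ⟨hk, Finset.mem_univ k⟩) (sub_self (d k))]
    simp

/-- A nonzero subspace stable under left multiplication by `t` is everything. -/
theorem eq_top_of_stable {σ : K ≃ₐ[F] K} {a : K} {m : ℕ} (hσ : σ ^ m = 1) (hm : 1 < m)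
    (ha : a ≠ 0) (hd : Function.Injective fun l : Fin m => (σ ^ (l : ℕ)) a)
    {W : Submodule K (Fin m → K)} (hW : ∀ w ∈ W, petitMul σ a m (mono m 1 1) w ∈ W)
    {w : Fin m → K} (hw : w ∈ W) (hw0 : w ≠ 0) : W = ⊤ := by
  have hpow (i : ℕ) (hi : i < m) (w : Fin m → K) (hw : w ∈ W) :
      petitMul σ a m (mono m i 1) w ∈ W := by
    induction i with
    | zero => simpa [mono_zero_petitMul] using hw
    | succ i ih =>
      have h := hW _ (ih (by omega))
      rw [← mono_petitMul_assoc a hσ (by omega), petitMul_mono_of_lt σ a (by omega)] at h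
      simpa [add_comm] using h
  have hdiag (w : Fin m → K) (hw : w ∈ W) : (fun l => w l * (σ ^ (l : ℕ)) a) ∈ W := by
    rw [← mono_one_petitMul_mono_pred a hσ hm]
    exact hW _ (hpow _ (by omega) w hw)
  obtain ⟨l, hl⟩ : ∃ l, w l ≠ 0 := by
    by_contra! h
    exact hw0 (funext h)
  have hP (k : ℕ) (c : K) (hk : k < m) (hc : c ≠ 0) (h : mono m k c ∈ W) :
      mono m k (1 : K) ∈ W := by
    simpa [smul_mono, hc] using W.smul_mem c⁻¹ h
  have hl1 : mono m l (1 : K) ∈ W := hP l _ l.2 hl (mono_mem_of_diagonal_stable hd hdiag hw l)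
  have hsucc (k : ℕ) (hk : k + 1 < m) (h : mono m k (1 : K) ∈ W) :
      mono m (k + 1) (1 : K) ∈ W := by
    have := hW _ h
    rw [petitMul_mono_of_lt σ a (by omega)] at this
    simpa [add_comm] using this
  have hlast : mono m (m - 1) (1 : K) ∈ W := by
    refine Nat.le_induction (P := fun k _ => k < m → mono m k (1 : K) ∈ W) (m := l)
      (fun _ => hl1) (fun k _ ih hk => hsucc k hk (ih (by omega))) (m - 1) (by omega) (by omega)
  have hzero : mono m 0 (1 : K) ∈ W := by
    have := hW _ hlast
    have e : 1 + (m - 1) - m = 0 := by omega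
    rw [petitMul_mono_of_le σ a (by omega) (by omega) (by omega), e] at this
    exact hP 0 _ (by omega) (by simpa using ha) this
  have hall (k : ℕ) (hk : k < m) : mono m k (1 : K) ∈ W := by
    induction k with
    | zero => exact hzero
    | succ k ih => exact hsucc k hk (ih (by omega))
  refine (Submodule.eq_top_iff').2 fun y => ?_
  rw [eq_sum_mono y]
  refine W.sum_mem fun j _ => ?_
  simpa [smul_mono] using W.smul_mem (y j) (hall j j.2)

theorem eq_zero_or_eq_zero_of_petitMul_eq_zero {σ : K ≃ₐ[F] K} {a : K} {m : ℕ}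
    (hσ : σ ^ m = 1) (hm : 1 < m)
    (ha : a ≠ 0) (hd : Function.Injective fun l : Fin m => (σ ^ (l : ℕ)) a)
    {x y : Fin m → K} (h : petitMul σ a m x y = 0) : x = 0 ∨ y = 0 := by
  by_contra! hxy
  obtain ⟨hx, hy⟩ := hxy
  set v : ℕ → Fin m → K := fun i => petitMul σ a m (mono m i 1) y with hv
  have hsum : ∑ i : Fin m, x i • v i = 0 := by
    rw [← h]
    conv_rhs => rw [eq_sum_mono x]
    change _ = mulRight σ a m y _
    rw [map_sum]
    refine Finset.sum_congr rfl fun i _ => ?_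
    change _ = petitMul σ a m _ y
    rw [hv, ← smul_petitMul, smul_mono, mul_one]
  have hvs (i : ℕ) (hi : i + 1 < m) : petitMul σ a m (mono m 1 1) (v i) = v (i + 1) := by
    simp only [hv]
    rw [← mono_petitMul_assoc a hσ (by omega), petitMul_mono_of_lt σ a (by omega)]
    simp [add_comm]
  obtain ⟨i₀, hi₀⟩ : ∃ i, x i ≠ 0 := by
    by_contra! h'
    exact hx (funext h')
  classical
  obtain ⟨d, hd0, hmax⟩ := Finset.exists_max_image (Finset.univ.filter fun i => x i ≠ 0) id
    ⟨i₀, by simpa using hi₀⟩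
  have hxd : x d ≠ 0 := by simpa using hd0
  have hgt (i : Fin m) (hi : d < i) : x i = 0 := by
    by_contra h'
    exact absurd (hmax i (by simpa using h')) (not_le.2 hi)
  set W : Submodule K (Fin m → K) := Submodule.span K (Set.range fun i : Fin (d : ℕ) => v i)
    with hWdef
  have hmem (i : ℕ) (hi : i < d) : v i ∈ W := Submodule.subset_span ⟨⟨i, hi⟩, rfl⟩
  have hvd : v d ∈ W := by
    have h1 : x d • v d = - ∑ i ∈ Finset.univ.erase d, x i • v i := by
      rw [eq_neg_iff_add_eq_zero, Finset.add_sum_erase _ (fun i : Fin m => x i • v i)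
        (Finset.mem_univ d), hsum]
    have h2 : x d • v d ∈ W := by
      rw [h1]
      refine W.neg_mem (W.sum_mem fun i hi => ?_)
      rcases lt_or_gt_of_ne (Finset.mem_erase.1 hi).1 with hlt | hlt
      · exact W.smul_mem _ (hmem i hlt)
      · simp [hgt i hlt]
    simpa [smul_smul, hxd] using W.smul_mem (x d)⁻¹ h2
  have hmem' (i : ℕ) (hi : i ≤ d) : v i ∈ W := by
    rcases hi.lt_or_eq with hi | rfl
    · exact hmem i hi
    · exact hvd
  have hW : ∀ w ∈ W, petitMul σ a m (mono m 1 1) w ∈ W := by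
    intro w hw
    induction hw using Submodule.span_induction with
    | mem w hw =>
      obtain ⟨i, rfl⟩ := hw
      have := i.2
      have := d.2
      simp only
      rw [hvs _ (by omega)]
      exact hmem' _ (by omega)
    | zero =>
      change mulLeft σ a m _ 0 ∈ W
      simp
    | add u w _ _ hu hw =>
      rw [petitMul_add]
      exact W.add_mem hu hw
    | smul c w _ hw =>
      rw [mono_one_petitMul_smul a hσ hm]
      exact W.smul_mem _ hw
  have hy' : y ∈ W := by
    have := hmem' 0 (Nat.zero_le _)
    simpa [hv, mono_zero_petitMul] using this
  have htop := eq_top_of_stable hσ hm ha hd hW hy' hy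
  have hle : Module.finrank K W ≤ d := by
    simpa [Set.finrank] using finrank_range_le_card (R := K) fun i : Fin (d : ℕ) => v i
  rw [htop, finrank_top, Module.finrank_fin_fun] at hle
  exact absurd d.2 (not_lt.2 hle)

/-- The twisted partial norm `y σ(y) ⋯ σ^(k-1)(y)`. -/
def partialNorm (σ : K ≃ₐ[F] K) (y : K) (k : ℕ) : K := ∏ i ∈ Finset.range k, (σ ^ i) y

theorem partialNorm_succ (σ : K ≃ₐ[F] K) (y : K) (k : ℕ) :
    partialNorm σ y (k + 1) = y * σ (partialNorm σ y k) := by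
  rw [partialNorm, Finset.prod_range_succ', partialNorm, map_prod, mul_comm]
  simp [pow_succ']

theorem partialNorm_add (σ : K ≃ₐ[F] K) (y : K) (i j : ℕ) :
    partialNorm σ y (i + j) = partialNorm σ y i * (σ ^ i) (partialNorm σ y j) := by
  simp only [partialNorm, Finset.prod_range_add, map_prod, pow_apply_pow_apply]

theorem partialNorm_ne_zero (σ : K ≃ₐ[F] K) {y : K} (hy : y ≠ 0) (k : ℕ) :
    partialNorm σ y k ≠ 0 :=
  Finset.prod_ne_zero_iff.2 fun _ _ => EmbeddingLike.map_ne_zero_iff.2 hy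

section Galois

variable [FiniteDimensional F K] [IsGalois F K]

theorem partialNorm_finrank {σ : K ≃ₐ[F] K} (hσ : ∀ τ, τ ∈ Subgroup.zpowers σ) (y : K) :
    partialNorm σ y (Module.finrank F K) = algebraMap F K (Algebra.norm F y) := by
  classical
  rw [Algebra.norm_eq_prod_automorphisms, partialNorm]
  refine Finset.prod_bij (fun i _ => σ ^ i) (fun _ _ => Finset.mem_univ _) ?_ ?_ fun _ _ => rfl
  · intro i hi j hj h
    exact pow_injOn hσ (Finset.mem_range.1 hi) (Finset.mem_range.1 hj) h
  · intro τ _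
    obtain ⟨i, hi, h⟩ := exists_pow_eq hσ τ
    exact ⟨i, Finset.mem_range.2 hi, h⟩

/-- If `τ a₁` is a norm times `a₂`, the two algebras are isomorphic. -/
theorem petitIso_of_apply_eq {σ : K ≃ₐ[F] K} (hσ : ∀ τ, τ ∈ Subgroup.zpowers σ) {a₁ a₂ : K}
    (τ : K ≃ₐ[F] K) {y : K} (hy : y ≠ 0)
    (h : τ a₁ = algebraMap F K (Algebra.norm F y) * a₂) :
    PetitIso σ σ a₁ a₂ (Module.finrank F K) := by
  set m := Module.finrank F K with hm
  set N := partialNorm σ y with hN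
  have hN0 (k : ℕ) : N k ≠ 0 := partialNorm_ne_zero σ hy k
  have hσm : σ ^ m = 1 := pow_finrank_eq_one σ
  let e : (Fin m → K) ≃ₗ[F] (Fin m → K) :=
    { toFun := fun x l => τ (x l) * N l
      invFun := fun x l => τ.symm (x l * (N l)⁻¹)
      map_add' := fun x z => by ext l; simp [add_mul]
      map_smul' := fun c x => by ext l; simp
      left_inv := fun x => by ext l; simp [hN0]
      right_inv := fun x => by ext l; simp [hN0] }
  have he (i : ℕ) (c : K) : e (mono m i c) = mono m i (τ c * N i) := by
    ext l
    change τ (mono m i c l) * N l = _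
    by_cases hl : (l : ℕ) = i <;> simp [mono, hl]
  have hτ (i : ℕ) (c : K) : τ ((σ ^ i) c) = (σ ^ i) (τ c) := by
    rw [← AlgEquiv.mul_apply, mul_comm_of_generates hσ, AlgEquiv.mul_apply]
  have hmono (i j : ℕ) (hi : i < m) (hj : j < m) (x z : K) :
      e (petitMul σ a₁ m (mono m i x) (mono m j z)) =
        petitMul σ a₂ m (e (mono m i x)) (e (mono m j z)) := by
    have hadd := partialNorm_add σ y i j
    by_cases hij : i + j < m
    · rw [petitMul_mono_of_lt σ a₁ hij, he, he, he, petitMul_mono_of_lt σ a₂ hij]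
      simp only [map_mul, hτ, hN, hadd]
      congr 1
      ring
    · obtain ⟨l, hl⟩ := Nat.exists_eq_add_of_le (not_lt.1 hij)
      have hl' : i + j - m = l := by omega
      rw [hl, partialNorm_add, hσm, ← hN, hm, hN, partialNorm_finrank hσ] at hadd
      rw [petitMul_mono_of_le σ a₁ hi hj (by omega), he, he, he,
        petitMul_mono_of_le σ a₂ hi hj (by omega), hl']
      simp only [map_mul, hτ, h, hN, AlgEquiv.commutes, AlgEquiv.one_apply] at hadd ⊢
      congr 1
      linear_combination τ x * (σ ^ i) (τ z) * (σ ^ l) a₂ * hadd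
  refine ⟨e, fun x z => ?_⟩
  have h1 (i : ℕ) (hi : i < m) (x : K) :
      e.toLinearMap.toAddMonoidHom.comp (mulLeft σ a₁ m (mono m i x)) =
        (mulLeft σ a₂ m (e (mono m i x))).comp e.toLinearMap.toAddMonoidHom :=
    addMonoidHom_ext_mono fun j hj z => hmono i j hi hj x z
  have h2 : e.toLinearMap.toAddMonoidHom.comp (mulRight σ a₁ m z) =
      (mulRight σ a₂ m (e z)).comp e.toLinearMap.toAddMonoidHom :=
    addMonoidHom_ext_mono fun i hi x => DFunLike.congr_fun (h1 i hi x) z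
  exact DFunLike.congr_fun h2 x

/-- An isomorphism of nonassociative cyclic algebras maps the copies of `K` to each other. -/
theorem exists_apply_mono_zero (hp : (Module.finrank F K).Prime) {σ₁ σ₂ : K ≃ₐ[F] K}
    (hσ₂ : ∀ τ, τ ∈ Subgroup.zpowers σ₂) {a₁ a₂ : K} (ha₂ : a₂ ∉ Set.range (algebraMap F K))
    {m : ℕ} (hm : Module.finrank F K = m) (e : (Fin m → K) ≃ₗ[F] (Fin m → K))
    (he : ∀ x y, e (petitMul σ₁ a₁ m x y) = petitMul σ₂ a₂ m (e x) (e y)) :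
    ∃ τ : K ≃ₐ[F] K, ∀ k, e (mono m 0 k) = mono m 0 (τ k) := by
  have h1m : 1 < m := hm ▸ hp.one_lt
  have hσ₁m : σ₁ ^ m = 1 := hm ▸ pow_finrank_eq_one σ₁
  have hσ₂m : σ₂ ^ m = 1 := hm ▸ pow_finrank_eq_one σ₂
  have hnuc (k : K) : e (mono m 0 k) = mono m 0 (e (mono m 0 k) ⟨0, by omega⟩) := by
    set z := e (mono m 0 k) with hz
    have hassoc (x y : Fin m → K) : petitMul σ₂ a₂ m (petitMul σ₂ a₂ m x y) z =
        petitMul σ₂ a₂ m x (petitMul σ₂ a₂ m y z) := by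
      have := congrArg e (petitMul_mono_zero_assoc a₁ hσ₁m (e.symm x) (e.symm y) k)
      simpa only [he, LinearEquiv.apply_symm_apply] using this
    have h := hassoc (mono m 1 1) (mono m (m - 1) 1)
    have e1 : 1 + (m - 1) - m = 0 := by omega
    rw [mono_one_petitMul_mono_pred a₂ hσ₂m h1m,
      petitMul_mono_of_le σ₂ a₂ (by omega) (by omega) (by omega), e1, mono_zero_petitMul] at h
    ext l
    have hl := congrFun h l
    simp only [Pi.smul_apply, smul_eq_mul, map_one, one_mul, pow_zero, AlgEquiv.one_apply] at hl
    simp only [mono]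
    split_ifs with h0
    · exact congrArg z (Fin.ext h0)
    · by_contra hzl
      have hfix : (σ₂ ^ (l : ℕ)) a₂ = a₂ :=
        mul_left_cancel₀ hzl (by rw [← hl, mul_comm])
      exact h0 (pow_injOn hσ₂ (hm ▸ l.2) (by omega)
        ((eq_one_of_apply_eq hp ha₂ hfix).trans (pow_zero σ₂).symm))
  let f : K →ₗ[F] K :=
    { toFun := fun k => e (mono m 0 k) ⟨0, by omega⟩
      map_add' := fun x y => by
        have : mono m 0 (x + y) = mono m 0 x + mono m 0 y := by
          ext l; by_cases h : (l : ℕ) = 0 <;> simp [mono, h]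
        rw [this, map_add, Pi.add_apply]
      map_smul' := fun c x => by
        have : mono m 0 (c • x) = c • mono m 0 x := by
          ext l; by_cases h : (l : ℕ) = 0 <;> simp [mono, h]
        rw [this, map_smul, Pi.smul_apply, RingHom.id_apply] }
  have hf (k : K) : e (mono m 0 k) = mono m 0 (f k) := hnuc k
  have hfmul (x y : K) : f (x * y) = f x * f y := by
    have h := he (mono m 0 x) (mono m 0 y)
    rw [hf, hf, petitMul_mono_of_lt σ₁ a₁ (by omega), petitMul_mono_of_lt σ₂ a₂ (by omega),
      add_zero, pow_zero, pow_zero, AlgEquiv.one_apply, AlgEquiv.one_apply, hf] at h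
    exact mono_injective (by omega) h
  have hf0 (k : K) (hk : f k = 0) : k = 0 := by
    have h := hf k
    have h0 : mono m 0 (0 : K) = 0 := by ext l; simp [mono]
    rw [hk, h0, e.map_eq_zero_iff] at h
    exact mono_injective (m := m) (i := 0) (by omega) (h.trans h0.symm)
  have hf1 : f 1 = 1 := by
    have h := hfmul 1 1
    rw [mul_one] at h
    exact mul_left_cancel₀ (fun h1 => one_ne_zero (hf0 1 h1)) (by rw [← h, mul_one])
  let τ : K →ₐ[F] K := AlgHom.ofLinearMap f hf1 hfmul
  exact ⟨AlgEquiv.ofBijective τ (Algebra.IsAlgebraic.algHom_bijective τ), hf⟩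

/-- Isomorphic nonassociative cyclic algebras of prime degree are defined by the same generator,
and their constants agree up to a Galois conjugation and a norm. -/
theorem eq_and_exists_of_petitIso (hp : (Module.finrank F K).Prime) {σ₁ σ₂ : K ≃ₐ[F] K}
    (hσ₁ : ∀ τ, τ ∈ Subgroup.zpowers σ₁)
    (hσ₂ : ∀ τ, τ ∈ Subgroup.zpowers σ₂) {a₁ a₂ : K} (ha₂ : a₂ ∉ Set.range (algebraMap F K))
    {m : ℕ} (hm : Module.finrank F K = m) (h : PetitIso σ₁ σ₂ a₁ a₂ m) :
    σ₁ = σ₂ ∧ ∃ (τ : K ≃ₐ[F] K) (y : K), y ≠ 0 ∧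
      τ a₁ = algebraMap F K (Algebra.norm F y) * a₂ := by
  obtain ⟨e, he⟩ := h
  obtain ⟨τ, hτ⟩ := exists_apply_mono_zero hp hσ₂ ha₂ hm e he
  have h1m : 1 < m := hm ▸ hp.one_lt
  have hσ₁m : σ₁ ^ m = 1 := hm ▸ pow_finrank_eq_one σ₁
  have hσ₂m : σ₂ ^ m = 1 := hm ▸ pow_finrank_eq_one σ₂
  have ha0 : a₂ ≠ 0 := fun h => ha₂ ⟨0, by simp [h]⟩
  have hgen (j c : ℕ) (hj : j < m) (hc : c < m) (hjc : σ₁ ^ j = σ₂ ^ c) :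
      ∃ y ≠ 0, e (mono m j 1) = mono m c y := by
    set w := e (mono m j 1) with hw
    have hw0 : w ≠ 0 := by
      rw [hw, Ne, e.map_eq_zero_iff]
      exact mono_ne_zero hj one_ne_zero
    have hcomm (k : K) : petitMul σ₂ a₂ m w (mono m 0 (τ k)) = (σ₂ ^ c) (τ k) • w := by
      have e1 : petitMul σ₁ a₁ m (mono m j 1) (mono m 0 k) =
          petitMul σ₁ a₁ m (mono m 0 ((σ₁ ^ j) k)) (mono m j 1) := by
        rw [petitMul_mono_of_lt σ₁ a₁ (by omega), petitMul_mono_of_lt σ₁ a₁ (by omega)]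
        simp
      have e2 := congrArg e e1
      rwa [he, he, hτ, hτ, mono_zero_petitMul, hjc, ← AlgEquiv.mul_apply,
        mul_comm_of_generates hσ₂, AlgEquiv.mul_apply] at e2
    have hsupp (l : Fin m) (hl : (l : ℕ) ≠ c) : w l = 0 := by
      by_contra hwl
      refine hl (pow_injOn hσ₂ (hm ▸ l.2) (hm ▸ hc) (AlgEquiv.ext fun k => ?_))
      have h2 : w l * (σ₂ ^ (l : ℕ)) k = (σ₂ ^ c) k * w l := by
        simpa only [petitMul_mono_zero, AlgEquiv.apply_symm_apply, Pi.smul_apply, smul_eq_mul]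
          using congrFun (hcomm (τ.symm k)) l
      exact mul_right_cancel₀ hwl (by rw [mul_comm, h2])
    have hwc : w = mono m c (w ⟨c, hc⟩) := by
      ext l
      simp only [mono]
      split_ifs with hl
      · exact congrArg w (Fin.ext hl)
      · exact hsupp l hl
    refine ⟨w ⟨c, hc⟩, fun h0 => hw0 ?_, hwc⟩
    rw [hwc, h0]
    ext l
    simp [mono]
  have hσ : σ₁ = σ₂ := by
    by_contra hne
    obtain ⟨c, hc, hcσ⟩ := exists_pow_eq hσ₂ σ₁
    obtain ⟨j, hj, hjσ⟩ := exists_pow_eq hσ₁ (σ₂ ^ (m - 1))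
    rw [hm] at hc hj
    have hc0 : c ≠ 0 := by
      rintro rfl
      have := pow_injOn hσ₁ (i := 1) (j := 0) (by omega) (by omega) (by simp [← hcσ])
      omega
    have hj1 : j + 1 < m := by
      by_contra hj1
      obtain rfl : j = m - 1 := by omega
      refine hne ?_
      have e1 : σ₁ ^ (m - 1) * σ₁ = 1 := by rw [← pow_succ, Nat.sub_add_cancel h1m.le, hσ₁m]
      have e2 : σ₂ ^ (m - 1) * σ₂ = 1 := by rw [← pow_succ, Nat.sub_add_cancel h1m.le, hσ₂m]
      rw [hjσ, ← e2] at e1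
      exact mul_left_cancel e1
    obtain ⟨y, hy, hey⟩ := hgen 1 c h1m hc (by rw [pow_one, hcσ])
    obtain ⟨z, hz, hez⟩ := hgen j (m - 1) hj (by omega) hjσ
    have h1 : petitMul σ₁ a₁ m (petitMul σ₁ a₁ m (mono m 1 1) (mono m j 1)) (mono m 1 1) =
        petitMul σ₁ a₁ m (mono m 1 1) (petitMul σ₁ a₁ m (mono m j 1) (mono m 1 1)) :=
      petitMul_assoc_mono a₁ hσ₁m h1m hj h1m (Or.inl (by omega)) 1 1 1
    have h2 := congrArg e h1
    have e1 : c + (m - 1) - m = c - 1 := by omega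
    have e2 : m - 1 + c - m = c - 1 := by omega
    have e3 : c - 1 + c = c + (c - 1) := by omega
    rw [he, he, he, he, hey, hez, petitMul_mono_of_le σ₂ a₂ hc (by omega) (by omega),
      petitMul_mono_of_le σ₂ a₂ (i := m - 1) (j := c) (by omega) hc (by omega), e1, e2,
      petitMul_mono σ₂ a₂ (by omega) hc, petitMul_mono σ₂ a₂ hc (by omega), e3] at h2
    have e4 : c + (m - 1) = m + (c - 1) := by omega
    have key : y * (σ₂ ^ c) z * (σ₂ ^ (c - 1)) a₂ * (σ₂ ^ (c - 1)) y =
        y * (σ₂ ^ c) (z * (σ₂ ^ (m - 1)) y * (σ₂ ^ (c - 1)) a₂) := by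
      split_ifs at h2 with hlt
      · exact mono_injective hlt h2
      · refine mul_right_cancel₀ ?_ (mono_injective (by omega) h2)
        exact EmbeddingLike.map_ne_zero_iff.2 ha0
    have hpow : σ₂ ^ (c + (m - 1)) = σ₂ ^ (c - 1) := by rw [e4, pow_add, hσ₂m, one_mul]
    simp only [map_mul, pow_apply_pow_apply, hpow] at key
    rw [pow_add, AlgEquiv.mul_apply] at key
    have hne0 (i : ℕ) (k : K) (hk : k ≠ 0) : (σ₂ ^ i) k ≠ 0 :=
      EmbeddingLike.map_ne_zero_iff.2 hk
    have hfix : (σ₂ ^ c) ((σ₂ ^ (c - 1)) a₂) = (σ₂ ^ (c - 1)) a₂ := by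
      refine mul_left_cancel₀ (mul_ne_zero (mul_ne_zero hy (hne0 c z hz)) (hne0 (c - 1) y hy)) ?_
      linear_combination -key
    rw [← AlgEquiv.mul_apply, mul_comm_of_generates hσ₂, AlgEquiv.mul_apply] at hfix
    have hc1 := eq_one_of_apply_eq hp ha₂ ((σ₂ ^ (c - 1)).injective hfix)
    exact hc0 (pow_injOn hσ₂ (by omega) (by omega) (hc1.trans (pow_zero σ₂).symm))
  subst hσ
  refine ⟨rfl, τ, ?_⟩
  obtain ⟨y, hy, hey⟩ := hgen 1 1 h1m h1m rfl
  refine ⟨y, hy, ?_⟩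
  have hk (k : ℕ) (hk : k < m) : e (mono m k 1) = mono m k (partialNorm σ₁ y k) := by
    induction k with
    | zero => simp [hτ, partialNorm]
    | succ k ih =>
      have h := he (mono m 1 1) (mono m k 1)
      rw [petitMul_mono_of_lt σ₁ a₁ (by omega), hey, ih (by omega),
        petitMul_mono_of_lt σ₁ a₂ (by omega)] at h
      simpa [add_comm 1 k, partialNorm_succ] using h
  have h := he (mono m 1 1) (mono m (m - 1) 1)
  have e1 : 1 + (m - 1) - m = 0 := by omega
  rw [petitMul_mono_of_le σ₁ a₁ h1m (by omega) (by omega), hey, hk _ (by omega),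
    petitMul_mono_of_le σ₁ a₂ h1m (by omega) (by omega), e1, hτ] at h
  have h' := mono_injective (by omega) h
  rw [pow_one, ← partialNorm_succ, Nat.sub_add_cancel h1m.le, ← hm, partialNorm_finrank hσ₁] at h'
  simpa using h'

end Galois

section Counting

variable (F K) in
/-- `Fˣ × Gal(K/F)` acts on `K ∖ F` by scaling and conjugation. -/
@[reducible]
def scaledGalois : MulAction (Fˣ × (K ≃ₐ[F] K)) {a : K // a ∉ Set.range (algebraMap F K)} where
  smul g a := ⟨algebraMap F K g.1 * g.2 a, by
    rintro ⟨x, hx⟩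
    refine a.2 ⟨(g.1⁻¹ : Fˣ) * x, g.2.injective ?_⟩
    rw [AlgEquiv.commutes, map_mul, hx, ← mul_assoc, ← map_mul]
    simp⟩
  one_smul a := Subtype.ext (by
    change algebraMap F K (1 : Fˣ) * (1 : K ≃ₐ[F] K) a = a
    simp)
  mul_smul g h a := Subtype.ext (by
    change algebraMap F K (g.1 * h.1 : Fˣ) * (g.2 * h.2) a =
      algebraMap F K g.1 * g.2 (algebraMap F K h.1 * h.2 a)
    simp [mul_assoc])

variable [FiniteDimensional F K] [IsGalois F K]

theorem generates_iff_ne_one (hp : (Module.finrank F K).Prime) (σ : K ≃ₐ[F] K) :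
    (∀ τ, τ ∈ Subgroup.zpowers σ) ↔ σ ≠ 1 := by
  constructor
  · rintro h rfl
    have := orderOf_of_generates h
    rw [orderOf_one] at this
    exact hp.one_lt.ne this
  · intro h τ
    have : Fact (Module.finrank F K).Prime := ⟨hp⟩
    exact mem_zpowers_of_prime_card (IsGalois.card_aut_eq_finrank F K) h

theorem card_generators (hp : (Module.finrank F K).Prime) :
    Nat.card {σ : K ≃ₐ[F] K // ∀ τ, τ ∈ Subgroup.zpowers σ} = Module.finrank F K - 1 := by
  classical
  rw [Nat.card_congr (Equiv.subtypeEquivRight (generates_iff_ne_one hp)),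
    Nat.card_eq_fintype_card, Fintype.card_subtype_compl, Fintype.card_subtype_eq,
    ← Nat.card_eq_fintype_card, IsGalois.card_aut_eq_finrank]

theorem card_fixed_of_orderOf_eq (hp : (Module.finrank F K).Prime) {τ : K ≃ₐ[F] K} (hτ : τ ≠ 1)
    {c : Fˣ} (hc : orderOf c = Module.finrank F K) :
    Nat.card {a : {a : K // a ∉ Set.range (algebraMap F K)} //
      algebraMap F K c * τ a = a} = Nat.card Fˣ := by
  have hcm : c ^ Module.finrank F K = 1 := hc ▸ pow_orderOf_eq_one c
  have hroot : (minpoly F τ.toLinearMap).IsRoot ((c⁻¹ : Fˣ) : F) := by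
    have h := congrArg Units.val (congrArg (·⁻¹) hcm)
    simp only [← inv_pow, inv_one, Units.val_pow_eq_pow_val, Units.val_one] at h
    rw [minpoly_algEquiv_toLinearMap τ (isOfFinOrder_of_finite τ),
      orderOf_of_generates ((generates_iff_ne_one hp τ).2 hτ)]
    simp only [Polynomial.IsRoot, Polynomial.eval_sub, Polynomial.eval_pow, Polynomial.eval_X,
      map_one, Polynomial.eval_one, h, sub_self]
  obtain ⟨b, hb⟩ := (Module.End.hasEigenvalue_of_isRoot hroot).exists_hasEigenvector
  have hb0 : b ≠ 0 := hb.2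
  have hcb : algebraMap F K c * τ b = b := by
    have h : τ b = ((c⁻¹ : Fˣ) : F) • b := hb.apply_eq_smul
    rw [h, Algebra.smul_def, ← mul_assoc, ← map_mul, Units.mul_inv, map_one, one_mul]
  have hbF (d : Fˣ) : algebraMap F K d * b ∉ Set.range (algebraMap F K) := by
    rintro ⟨x, hx⟩
    have hx' : b = algebraMap F K ((d⁻¹ : Fˣ) * x) := by
      rw [map_mul, hx, ← mul_assoc, ← map_mul]
      simp
    rw [hx', AlgEquiv.commutes, ← map_mul] at hcb
    have h1 := (algebraMap F K).injective hcb
    have h0 : ((d⁻¹ : Fˣ) : F) * x ≠ 0 := fun h => hb0 (by rw [hx', h, map_zero])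
    have : c = 1 := Units.ext (mul_right_cancel₀ h0 (by rw [h1, Units.val_one, one_mul]))
    rw [this, orderOf_one] at hc
    exact hp.one_lt.ne hc
  have hfixed (d : Fˣ) : algebraMap F K c * τ (algebraMap F K d * b) = algebraMap F K d * b := by
    rw [map_mul, AlgEquiv.commutes]
    linear_combination algebraMap F K d * hcb
  refine (Nat.card_congr (Equiv.ofBijective
    (fun d : Fˣ => ⟨⟨algebraMap F K d * b, hbF d⟩, hfixed d⟩) ⟨?_, ?_⟩)).symm
  · intro d d' h
    have h' : algebraMap F K d * b = algebraMap F K d' * b :=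
      congrArg (fun z => ((z.1 : {a : K // a ∉ Set.range (algebraMap F K)}) : K)) h
    exact Units.ext ((algebraMap F K).injective (mul_right_cancel₀ hb0 h'))
  · rintro ⟨⟨a, ha⟩, hca⟩
    change algebraMap F K c * τ a = a at hca
    have hfix : τ (a / b) = a / b := by
      have hc0 : algebraMap F K c ≠ 0 := by simp
      rw [map_div₀]
      conv_rhs => rw [← hca, ← hcb]
      rw [mul_div_mul_left _ _ hc0]
    obtain ⟨x, hx⟩ : a / b ∈ Set.range (algebraMap F K) := by
      by_contra h
      exact hτ (eq_one_of_apply_eq hp h hfix)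
    have hxb : algebraMap F K x * b = a := by rw [hx, div_mul_cancel₀ _ hb0]
    have hx0 : x ≠ 0 := by
      rintro rfl
      exact ha ⟨0, by rw [← hxb]; simp⟩
    exact ⟨Units.mk0 x hx0, Subtype.ext (Subtype.ext hxb)⟩

theorem card_fixed_of_orderOf_ne (hp : (Module.finrank F K).Prime) {τ : K ≃ₐ[F] K} (hτ : τ ≠ 1)
    {c : Fˣ} (hc : orderOf c ≠ Module.finrank F K) :
    Nat.card {a : {a : K // a ∉ Set.range (algebraMap F K)} //
      algebraMap F K c * τ a = a} = 0 := by
  have : IsEmpty {a : {a : K // a ∉ Set.range (algebraMap F K)} //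
      algebraMap F K c * τ a = a} := by
    refine ⟨fun ⟨⟨a, ha⟩, h⟩ => ?_⟩
    change algebraMap F K c * τ a = a at h
    have ha0 : a ≠ 0 := fun h => ha ⟨0, by simp [h]⟩
    have hn := congrArg (Algebra.norm F) h
    rw [map_mul, Algebra.norm_algebraMap, Algebra.norm_eq_of_algEquiv] at hn
    have hc1 : c ^ Module.finrank F K = 1 := by
      refine Units.ext (mul_right_cancel₀ (Algebra.norm_ne_zero_iff.2 ha0 : Algebra.norm F a ≠ 0) ?_)
      rw [Units.val_pow_eq_pow_val, hn, Units.val_one, one_mul]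
    rcases (Nat.dvd_prime hp).1 (orderOf_dvd_of_pow_eq_one hc1) with h1 | h1
    · rw [orderOf_eq_one_iff] at h1
      rw [h1, Units.val_one, map_one, one_mul] at h
      exact hτ (eq_one_of_apply_eq hp ha h)
    · exact hc h1
  exact Nat.card_of_isEmpty

omit [FiniteDimensional F K] [IsGalois F K] in
theorem card_fixed_one_of_ne {c : Fˣ} (hc : c ≠ 1) :
    Nat.card {a : {a : K // a ∉ Set.range (algebraMap F K)} //
      algebraMap F K c * (1 : K ≃ₐ[F] K) a = a} = 0 := by
  have : IsEmpty {a : {a : K // a ∉ Set.range (algebraMap F K)} //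
      algebraMap F K c * (1 : K ≃ₐ[F] K) a = a} := by
    refine ⟨fun ⟨⟨a, ha⟩, h⟩ => ?_⟩
    change algebraMap F K c * a = a at h
    have ha0 : a ≠ 0 := fun h => ha ⟨0, by simp [h]⟩
    refine hc (Units.ext ((algebraMap F K).injective (mul_right_cancel₀ ha0 ?_)))
    rw [h, Units.val_one, map_one, one_mul]
  exact Nat.card_of_isEmpty

omit [IsGalois F K] in
theorem card_compl_range [Fintype F] :
    Nat.card {a : K // a ∉ Set.range (algebraMap F K)} =
      Fintype.card F ^ Module.finrank F K - Fintype.card F := by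
  classical
  have : Finite K := Module.finite_of_finite F
  have := Fintype.ofFinite K
  rw [Nat.card_eq_fintype_card, Fintype.card_subtype_compl, ← Module.card_eq_pow_finrank (K := F)]
  congr 1
  exact (Set.card_range_of_injective (algebraMap F K).injective)

theorem sum_card_fixed [Fintype F] [DecidableEq F] [DecidableEq (K ≃ₐ[F] K)] (hp : (Module.finrank F K).Prime)
    (hd : Module.finrank F K ∣ Fintype.card F - 1) (τ : K ≃ₐ[F] K) :
    ∑ c : Fˣ, Nat.card {a : {a : K // a ∉ Set.range (algebraMap F K)} //
      algebraMap F K c * τ a = a} =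
      if τ = 1 then Fintype.card F ^ Module.finrank F K - Fintype.card F
      else (Module.finrank F K - 1) * (Fintype.card F - 1) := by
  split_ifs with hτ
  · subst hτ
    rw [Finset.sum_eq_single 1 (fun c _ hc => card_fixed_one_of_ne hc) (by simp)]
    rw [← card_compl_range (K := K)]
    exact Nat.card_congr (Equiv.subtypeUnivEquiv fun a => by simp)
  · have h (c : Fˣ) : Nat.card {a : {a : K // a ∉ Set.range (algebraMap F K)} //
        algebraMap F K c * τ a = a} =
        if orderOf c = Module.finrank F K then Fintype.card F - 1 else 0 := by
      split_ifs with hc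
      · rw [card_fixed_of_orderOf_eq hp hτ hc, Nat.card_eq_fintype_card, Fintype.card_units]
      · exact card_fixed_of_orderOf_ne hp hτ hc
    rw [Finset.sum_congr rfl fun c _ => h c, ← Finset.sum_filter, Finset.sum_const, smul_eq_mul,
      IsCyclic.card_orderOf_eq_totient (by rwa [Fintype.card_units]), Nat.totient_prime hp]

/-- Burnside's lemma for the action of `Fˣ × Gal(K/F)` on `K ∖ F`. -/
theorem card_orbits_mul [Fintype F] (hp : (Module.finrank F K).Prime)
    (hd : Module.finrank F K ∣ Fintype.card F - 1) :
    letI := scaledGalois F K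
    Nat.card (MulAction.orbitRel.Quotient (Fˣ × (K ≃ₐ[F] K))
        {a : K // a ∉ Set.range (algebraMap F K)}) *
      (Module.finrank F K * (Fintype.card F - 1)) =
      Fintype.card F ^ Module.finrank F K - Fintype.card F +
        (Module.finrank F K - 1) * ((Module.finrank F K - 1) * (Fintype.card F - 1)) := by
  classical
  let := scaledGalois F K
  have : Finite K := Module.finite_of_finite F
  have := Fintype.ofFinite K
  have hG : Fintype.card (K ≃ₐ[F] K) = Module.finrank F K := by
    rw [← Nat.card_eq_fintype_card, IsGalois.card_aut_eq_finrank]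
  have hB := MulAction.sum_card_fixedBy_eq_card_orbits_mul_card_group (Fˣ × (K ≃ₐ[F] K))
    {a : K // a ∉ Set.range (algebraMap F K)}
  rw [Fintype.card_prod, hG, Fintype.card_units, mul_comm (Fintype.card F - 1),
    Fintype.sum_prod_type_right] at hB
  have hfix (τ : K ≃ₐ[F] K) (c : Fˣ) :
      Fintype.card (MulAction.fixedBy {a : K // a ∉ Set.range (algebraMap F K)} (c, τ)) =
      Nat.card {a : {a : K // a ∉ Set.range (algebraMap F K)} //
        algebraMap F K c * τ a = a} := by
    rw [← Nat.card_eq_fintype_card]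
    exact Nat.card_congr (Equiv.subtypeEquivRight fun a => Subtype.ext_iff)
  simp only [hfix, sum_card_fixed hp hd] at hB
  rw [Nat.card_eq_fintype_card]
  rw [← Finset.add_sum_erase _ _ (Finset.mem_univ (1 : K ≃ₐ[F] K)), if_pos rfl,
    Finset.sum_congr rfl fun τ hτ => if_neg (Finset.ne_of_mem_erase hτ), Finset.sum_const,
    Finset.card_erase_of_mem (Finset.mem_univ _), Finset.card_univ, hG, smul_eq_mul] at hB
  exact hB.symm

theorem petitIso_iff [Fintype F] (hp : (Module.finrank F K).Prime) {σ₁ σ₂ : K ≃ₐ[F] K}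
    (hσ₁ : ∀ τ, τ ∈ Subgroup.zpowers σ₁) (hσ₂ : ∀ τ, τ ∈ Subgroup.zpowers σ₂)
    (a₁ a₂ : {a : K // a ∉ Set.range (algebraMap F K)}) :
    letI := scaledGalois F K
    PetitIso σ₁ σ₂ (a₁ : K) a₂ (Module.finrank F K) ↔
      σ₁ = σ₂ ∧ MulAction.orbitRel (Fˣ × (K ≃ₐ[F] K)) _ a₁ a₂ := by
  let := scaledGalois F K
  have : Finite K := Module.finite_of_finite F
  rw [MulAction.orbitRel_apply]
  constructor
  · intro h
    obtain ⟨hσ, τ, y, hy, h⟩ := eq_and_exists_of_petitIso hp hσ₁ hσ₂ a₂.2 rfl h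
    refine ⟨hσ, (Units.mk0 (Algebra.norm F y) (Algebra.norm_ne_zero_iff.2 hy), τ.symm),
      Subtype.ext ?_⟩
    change algebraMap F K (Algebra.norm F y) * τ.symm a₂ = a₁
    apply τ.injective
    rw [map_mul, AlgEquiv.commutes, AlgEquiv.apply_symm_apply, h]
  · rintro ⟨rfl, ⟨c, τ⟩, h⟩
    have h' : algebraMap F K c * τ a₂ = a₁ := congrArg Subtype.val h
    obtain ⟨y, hy⟩ := FiniteField.norm_surjective F K (c : F)
    have hy0 : y ≠ 0 := by
      rintro rfl
      rw [Algebra.norm_zero] at hy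
      exact c.ne_zero hy.symm
    refine petitIso_of_apply_eq hσ₁ τ.symm hy0 ?_
    rw [← h', map_mul, AlgEquiv.commutes, AlgEquiv.symm_apply_apply, hy]

end Counting

end Petit

/-- Let `q` be a prime power and `m` a prime dividing
`q - 1`. Each nonassociative cyclic algebra `(𝔽_{q^m}/𝔽_q, σ, a)` (with `σ` a
generator of the Galois group and `a ∈ 𝔽_{q^m} ∖ 𝔽_q`) is a division algebra,
and the number of classes of pairs `(σ, a)` up to isomorphism of the associated
algebras equals `(m-1)·((m-1) + (q^m - q - (q-1)(m-1))/(m(q-1)))`, the inner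
quotient being an integer. -/
theorem stmt_14 {F K : Type*} [Field F] [Fintype F] [Field K] [Algebra F K]
    [IsGalois F K]
    (q m : ℕ) (hq : IsPrimePow q) (hcard : Fintype.card F = q)
    (hm : Nat.Prime m) (hd : m ∣ q - 1)
    (hdeg : Module.finrank F K = m) :
    (∀ σ : K ≃ₐ[F] K, (∀ τ : K ≃ₐ[F] K, τ ∈ Subgroup.zpowers σ) →
      ∀ a : K, a ∉ Set.range (algebraMap F K) →
      ∀ x y : Fin m → K, petitMul σ a m x y = 0 → x = 0 ∨ y = 0) ∧
    m * (q - 1) ∣ (q ^ m - q - (q - 1) * (m - 1)) ∧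
    ∃ c : {p : (K ≃ₐ[F] K) × K //
        (∀ τ : K ≃ₐ[F] K, τ ∈ Subgroup.zpowers p.1) ∧
        p.2 ∉ Set.range (algebraMap F K)} →
        Fin ((m - 1) * ((m - 1) + (q ^ m - q - (q - 1) * (m - 1)) / (m * (q - 1)))),
      Function.Surjective c ∧
      ∀ p p', c p = c p' ↔ PetitIso p.1.1 p'.1.1 p.1.2 p'.1.2 m := by
  subst hdeg hcard
  have : FiniteDimensional F K := Module.finite_of_finrank_pos hm.pos
  have hq2 : 1 < Fintype.card F := Fintype.one_lt_card
  refine ⟨fun σ hσ a ha x y h => ?_, ?_⟩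
  · refine Petit.eq_zero_or_eq_zero_of_petitMul_eq_zero (Petit.pow_finrank_eq_one σ) hm.one_lt
      (fun h0 => ha ⟨0, by simp [h0]⟩) (fun i j hij => ?_) h
    have hgen (i j : Fin (Module.finrank F K)) (hle : i ≤ j)
        (hij : (σ ^ (i : ℕ)) a = (σ ^ (j : ℕ)) a) : i = j := by
      obtain ⟨d, hd⟩ := Nat.exists_eq_add_of_le (Fin.le_def.1 hle)
      rw [hd, pow_add, AlgEquiv.mul_apply] at hij
      have h1 := Petit.eq_one_of_apply_eq hm ha ((σ ^ (i : ℕ)).injective hij).symm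
      have h2 := Petit.pow_injOn hσ (by omega) hm.pos (h1.trans (pow_zero σ).symm)
      exact Fin.ext (by omega)
    rcases le_total i j with hle | hle
    · exact hgen i j hle hij
    · exact (hgen j i hle hij.symm).symm
  set q := Fintype.card F with hq_def
  set m := Module.finrank F K with hm_def
  let := Petit.scaledGalois F K
  set O := MulAction.orbitRel.Quotient (Fˣ × (K ≃ₐ[F] K))
    {a : K // a ∉ Set.range (algebraMap F K)} with hO
  have hcount : Nat.card O * (m * (q - 1)) =
      q ^ m - q + (m - 1) * ((m - 1) * (q - 1)) := Petit.card_orbits_mul hm hd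
  have hpos : 0 < m * (q - 1) := Nat.mul_pos hm.pos (by omega)
  obtain ⟨k, hk⟩ : ∃ k, m = k + 1 := ⟨m - 1, by have := hm.pos; omega⟩
  obtain ⟨r, hr⟩ : ∃ r, q = r + 1 := ⟨q - 1, by omega⟩
  have hbig : q + (q - 1) * (m - 1) ≤ q ^ m := by
    have h1 : m ≤ q ^ (m - 1) := by
      have := Nat.lt_pow_self (n := m - 1) hq2
      omega
    calc q + (q - 1) * (m - 1) ≤ q + q * (m - 1) := by gcongr; omega
      _ = q * m := by rw [hk, Nat.add_sub_cancel]; ring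
      _ ≤ q * q ^ (m - 1) := by gcongr
      _ = q ^ m := by rw [hk, Nat.add_sub_cancel]; ring
  obtain ⟨s, hs⟩ := Nat.exists_eq_add_of_le hbig
  have hs' : q ^ m - q - (q - 1) * (m - 1) = s := by omega
  have hs'' : q ^ m - q = (q - 1) * (m - 1) + s := by omega
  have heq : Nat.card O * (m * (q - 1)) = m * (q - 1) * (m - 1) + s := by
    rw [hcount, hs'']
    have : m * (q - 1) * (m - 1) =
        (q - 1) * (m - 1) + (m - 1) * ((m - 1) * (q - 1)) := by
      rw [hk, Nat.add_sub_cancel]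
      ring
    omega
  have hdvd : m * (q - 1) ∣ s :=
    (Nat.dvd_add_right (Dvd.intro _ rfl)).1 (heq ▸ Dvd.intro_left _ rfl)
  rw [hs']
  refine ⟨hdvd, ?_⟩
  obtain ⟨u, hu⟩ := hdvd
  have hOcard : Nat.card O = (m - 1) + s / (m * (q - 1)) := by
    rw [hu, Nat.mul_div_cancel_left _ hpos]
    refine Nat.eq_of_mul_eq_mul_right hpos ?_
    rw [heq, hu]
    ring
  have : Finite K := Module.finite_of_finite F
  have : Finite O := Quotient.finite _
  have hcard : Nat.card ({σ : K ≃ₐ[F] K // ∀ τ, τ ∈ Subgroup.zpowers σ} × O) =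
      (m - 1) * ((m - 1) + s / (m * (q - 1))) := by
    rw [Nat.card_prod, Petit.card_generators hm, hOcard]
  let E := Finite.equivFinOfCardEq hcard
  refine ⟨fun p => E (⟨p.1.1, p.2.1⟩, Quotient.mk'' ⟨p.1.2, p.2.2⟩), ?_, fun p p' => ?_⟩
  · intro n
    obtain ⟨⟨⟨σ, hσ⟩, o⟩, rfl⟩ := E.surjective n
    obtain ⟨⟨a, ha⟩, rfl⟩ := Quotient.exists_rep o
    exact ⟨⟨(σ, a), hσ, ha⟩, rfl⟩
  · rw [Petit.petitIso_iff hm p.2.1 p'.2.1 ⟨p.1.2, p.2.2⟩ ⟨p'.1.2, p'.2.2⟩, E.injective.eq_iff,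
      Prod.mk.injEq, Subtype.mk.injEq, Quotient.eq'']
end

section
/- Let F be a finite field of odd characteristic, let K/F be a cyclic Galois field extension of degree 4 with Gal(K/F) = ⟨σ⟩, and let E = Fix(σ²) be the unique quadratic intermediate field of K/F. Then for a ∈ K ∖ F, the nonassociative cyclic algebra (K/F, σ, a) of degree 4 is a division algebra if and only if a ∉ E. -/
/-- Left multiplication by `t` in `K[t;σ]/K[t;σ](t^4 - a)`. -/
def petitShift {K : Type*} [Field K] (σ : K ≃+* K) (a : K) :
    (Fin 4 → K) →ₛₗ[(σ : K →+* K)] (Fin 4 → K) where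
  toFun v := ![σ (v 3) * a, σ (v 0), σ (v 1), σ (v 2)]
  map_add' v w := by
    ext i; fin_cases i <;> simp [add_mul]
  map_smul' c v := by
    ext i; fin_cases i <;> simp [mul_assoc]

theorem petitShift_apply {K : Type*} [Field K] (σ : K ≃+* K) (a : K) (v : Fin 4 → K) :
    petitShift σ a v = ![σ (v 3) * a, σ (v 0), σ (v 1), σ (v 2)] :=
  rfl

theorem petitMul_four_eq {F K : Type*} [Field F] [Field K] [Algebra F K]
    (σ : K ≃ₐ[F] K) (a : K) (x y : Fin 4 → K) :
    petitMul σ a 4 x y = x 0 • y + x 1 • petitShift (σ : K ≃+* K) a y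
      + x 2 • petitShift (σ : K ≃+* K) a (petitShift (σ : K ≃+* K) a y)
      + x 3 • petitShift (σ : K ≃+* K) a
          (petitShift (σ : K ≃+* K) a (petitShift (σ : K ≃+* K) a y)) := by
  ext l
  simp only [petitShift_apply, Pi.add_apply, Pi.smul_apply]
  fin_cases l <;>
    simp [petitMul, Fin.sum_univ_four, pow_succ, AlgEquiv.mul_apply] <;> ring

/-- If `σ²` does not fix `a`, then `K[t;σ]/K[t;σ](t^4 - a)` has no proper nonzero
`K[t;σ]`-submodule. -/
theorem eq_top_of_petitShift_mem {K : Type*} [Field K] (σ : K ≃+* K)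
    (hσ : ∀ x, σ (σ (σ (σ x))) = x) {a : K} (ha : σ (σ a) ≠ a)
    (W : Submodule K (Fin 4 → K)) (hT : ∀ v ∈ W, petitShift σ a v ∈ W) (hW : W ≠ ⊥) :
    W = ⊤ := by
  have shift (p q r s : K) (h : ![p, q, r, s] ∈ W) : ![σ s * a, σ p, σ q, σ r] ∈ W :=
    hT _ h
  have monic {v w : Fin 4 → K} (c : K) (h : v ∈ W) (hc : c ≠ 0) (e : v = c • w) : w ∈ W := by
    rw [e] at h
    exact (W.smul_mem_iff hc).1 h
  have const (p : K) (h : ![p, 0, 0, 0] ∈ W) (hp : p ≠ 0) : W = ⊤ := by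
    have h0 : ![1, 0, 0, 0] ∈ W := monic p h hp (by ext i; fin_cases i <;> simp)
    have h1 := shift _ _ _ _ h0
    have h2 := shift _ _ _ _ h1
    have h3 := shift _ _ _ _ h2
    refine eq_top_iff.2 fun v _ => ?_
    convert W.add_mem (W.add_mem (W.smul_mem (v 0) h0) (W.smul_mem (v 1) h1))
      (W.add_mem (W.smul_mem (v 2) h2) (W.smul_mem (v 3) h3)) using 1
    ext i; fin_cases i <;> simp
  have linear (b : K) (h : ![b, 1, 0, 0] ∈ W) : W = ⊤ := by
    have h1 := shift _ _ _ _ h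
    have h2 := shift _ _ _ _ h1
    have h3 := shift _ _ _ _ h2
    refine const (a - σ (σ (σ b)) * σ (σ b) * σ b * b) ?_ fun e => ha ?_
    · convert W.sub_mem (W.add_mem (W.sub_mem h3 (W.smul_mem (σ (σ (σ b))) h2))
        (W.smul_mem (σ (σ (σ b)) * σ (σ b)) h1))
        (W.smul_mem (σ (σ (σ b)) * σ (σ b) * σ b) h) using 1
      ext i; fin_cases i <;> simp
    · rw [sub_eq_zero.1 e]
      simp only [map_mul, hσ]
      ring
  have deg_one (p q : K) (h : ![p, q, 0, 0] ∈ W) (hpq : ¬ (p = 0 ∧ q = 0)) : W = ⊤ := by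
    by_cases hq : q = 0
    · subst hq
      exact const p h (by simpa using hpq)
    · exact linear (p / q) (monic q h hq (by ext i; fin_cases i <;> simp [mul_div_cancel₀, hq]))
  have quadratic (c b : K) (h : ![c, b, 1, 0] ∈ W) : W = ⊤ := by
    have h1 := shift _ _ _ _ h
    have h2 := shift _ _ _ _ h1
    refine deg_one (a - (σ (σ c) - σ (σ b) * σ b) * c)
      (-(σ (σ b) * σ c) - (σ (σ c) - σ (σ b) * σ b) * b) ?_ ?_
    · convert W.sub_mem (W.sub_mem h2 (W.smul_mem (σ (σ b)) h1))
        (W.smul_mem (σ (σ c) - σ (σ b) * σ b) h) using 1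
      ext i; fin_cases i <;> simp
    · rintro ⟨e0, e1⟩
      apply ha
      rw [sub_eq_zero.1 e0]
      by_cases hb : b = 0
      · subst hb
        simp [hσ, mul_comm]
      obtain ⟨e, rfl⟩ : ∃ e, c = b * σ (σ (σ b)) * e :=
        ⟨c / (b * σ (σ (σ b))), by field_simp [hb]⟩
      have key : σ (σ e) = 1 - σ e := by
        have : b * σ b * σ (σ b) * (σ (σ e) - (1 - σ e)) = 0 := by
          simp only [map_mul, hσ] at e1
          linear_combination -e1
        simpa [hb, sub_eq_zero] using this
      have key' : σ e = 1 - e := σ.injective (by simpa using key)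
      simp only [map_mul, map_sub, map_one, hσ, key']
      ring
  have deg_two (p q r : K) (h : ![p, q, r, 0] ∈ W) (hpq : ¬ (p = 0 ∧ q = 0 ∧ r = 0)) :
      W = ⊤ := by
    by_cases hr : r = 0
    · subst hr
      exact deg_one p q h (by simpa using hpq)
    · exact quadratic (p / r) (q / r)
        (monic r h hr (by ext i; fin_cases i <;> simp [mul_div_cancel₀, hr]))
  have cubic (d c b : K) (h : ![d, c, b, 1] ∈ W) : W = ⊤ := by
    have h1 := shift _ _ _ _ h
    refine deg_two (a - σ b * d) (σ d - σ b * c) (σ c - σ b * b) ?_ ?_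
    · convert W.sub_mem h1 (W.smul_mem (σ b) h) using 1
      ext i; fin_cases i <;> simp
    · rintro ⟨e0, e1, e2⟩
      apply ha
      have hc : c = σ (σ (σ b)) * b := by
        rw [← hσ c, sub_eq_zero.1 e2, map_mul, map_mul, map_mul, hσ, mul_comm]
      have hd : d = b * σ (σ (σ b)) * σ (σ b) := by
        rw [← hσ d, sub_eq_zero.1 e1, hc]
        simp only [map_mul, hσ]
        ring
      rw [sub_eq_zero.1 e0, hd]
      simp only [map_mul, hσ]
      ring
  obtain ⟨v, hv, hv0⟩ := W.exists_mem_ne_zero_of_ne_bot hW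
  have hv' : v = ![v 0, v 1, v 2, v 3] := by ext i; fin_cases i <;> rfl
  by_cases h3 : v 3 = 0
  · refine deg_two (v 0) (v 1) (v 2) (by rwa [← h3, ← hv']) ?_
    rintro ⟨e0, e1, e2⟩
    exact hv0 (by ext i; fin_cases i <;> assumption)
  · exact cubic (v 0 / v 3) (v 1 / v 3) (v 2 / v 3)
      (monic (v 3) hv h3 (by ext i; fin_cases i <;> simp [mul_div_cancel₀, h3]))

/-- If `σ²` does not fix `a`, then `y, ty, t²y, t³y` are linearly independent for `y ≠ 0`. -/
theorem eq_zero_of_petitShift_relation {K : Type*} [Field K] (σ : K ≃+* K)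
    (hσ : ∀ x, σ (σ (σ (σ x))) = x) {a : K} (ha : σ (σ a) ≠ a) {y : Fin 4 → K} (hy : y ≠ 0)
    {p q r s : K} (h : p • y + q • petitShift σ a y + r • petitShift σ a (petitShift σ a y)
      + s • petitShift σ a (petitShift σ a (petitShift σ a y)) = 0) :
    p = 0 ∧ q = 0 ∧ r = 0 ∧ s = 0 := by
  set T := petitShift σ a
  have main (p q r s : K) (h : p • y + q • T y + r • T (T y) + s • T (T (T y)) = 0) : s = 0 := by
    by_contra hs
    have hmem : T (T (T y)) ∈ Submodule.span K {y, T y, T (T y)} := by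
      refine Submodule.mem_span_triple.2 ⟨-(p / s), -(q / s), -(r / s), ?_⟩
      refine smul_right_injective _ hs ?_
      simp only [smul_add, smul_smul, mul_neg, mul_div_cancel₀ _ hs]
      linear_combination (norm := module) (-1 : K) • h
    have htop : Submodule.span K {y, T y, T (T y)} = ⊤ := by
      refine eq_top_of_petitShift_mem σ hσ ha _ (fun v hv => ?_) fun hbot => hy ?_
      · obtain ⟨c, d, e, rfl⟩ := Submodule.mem_span_triple.1 hv
        change T _ ∈ _
        simp only [map_add, LinearMap.map_smulₛₗ]
        refine add_mem (add_mem (Submodule.smul_mem _ _ ?_) (Submodule.smul_mem _ _ ?_))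
          (Submodule.smul_mem _ _ hmem) <;> exact Submodule.subset_span (by simp)
      · exact (Submodule.mem_bot K).1 (hbot ▸ Submodule.subset_span (by simp))
    classical
    have hle := finrank_span_finset_le_card (R := K) ({y, T y, T (T y)} : Finset (Fin 4 → K))
    have hcard := Finset.card_le_three (a := y) (b := T y) (c := T (T y))
    rw [Finset.coe_insert, Finset.coe_pair, Set.finrank, htop, finrank_top,
      Module.finrank_fin_fun] at hle
    omega
  have step (p q r : K) (h : p • y + q • T y + r • T (T y) = 0) :
      (0 : K) • y + σ p • T y + σ q • T (T y) + σ r • T (T (T y)) = 0 := by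
    have := congrArg T h
    simpa [LinearMap.map_smulₛₗ] using this
  have hs := main _ _ _ _ h
  subst hs
  rw [zero_smul, add_zero] at h
  have hr : r = 0 := by simpa using main _ _ _ _ (step _ _ _ h)
  subst hr
  have hq : q = 0 := by
    have h1 := step p q 0 h
    rw [map_zero, zero_smul _ (T (T (T y))), add_zero] at h1
    simpa using main _ _ _ _ (step _ _ _ h1)
  subst hq
  rw [zero_smul, zero_smul, add_zero, add_zero] at h
  exact ⟨(smul_eq_zero.1 h).resolve_right hy, rfl, rfl, rfl⟩

theorem exists_mul_eq_of_mem_fixedField_zpowers {F K : Type*} [Field F] [Field K] [Finite K]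
    [Algebra F K] [FiniteDimensional F K] {τ : K ≃ₐ[F] K} (hτ : orderOf τ = 2) {a : K}
    (ha : a ∈ IntermediateField.fixedField (Subgroup.zpowers τ)) : ∃ c, c * τ c = a := by
  classical
  set H := Subgroup.zpowers τ
  obtain ⟨c, hc⟩ := FiniteField.norm_surjective (IntermediateField.fixedField H) K ⟨a, ha⟩
  refine ⟨c, ?_⟩
  have h := Algebra.norm_eq_prod_automorphisms (IntermediateField.fixedField H) c
  rw [hc] at h
  have happly (x : H) : IntermediateField.subgroupEquivAlgEquiv H x c = (x : K ≃ₐ[F] K) c := rfl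
  rw [← (((finCongr hτ.symm).trans (finEquivZPowers (isOfFinOrder_of_finite τ))).trans
    (IntermediateField.subgroupEquivAlgEquiv H).toEquiv).prod_comp, Fin.prod_univ_two] at h
  simpa [happly, finEquivZPowers_apply] using h.symm

/-- Let `F` be a finite field of odd characteristic, `K/F`
cyclic Galois of degree 4 with `Gal(K/F) = ⟨σ⟩`, and `E = Fix(σ²)` the unique
quadratic intermediate field. Then for `a ∈ K ∖ F`, the nonassociative cyclic
algebra `(K/F, σ, a)` of degree 4 is a division algebra iff `a ∉ E`. -/
theorem stmt_15 {F K : Type*} [Field F] [Finite F] [Field K] [Algebra F K]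
    [IsGalois F K]
    (hchar : ringChar F ≠ 2)
    (hdeg : Module.finrank F K = 4)
    (σ : K ≃ₐ[F] K)
    (hgen : ∀ τ : K ≃ₐ[F] K, τ ∈ Subgroup.zpowers σ)
    (a : K) (ha : a ∉ Set.range (algebraMap F K)) :
    (∀ x y : Fin 4 → K, petitMul σ a 4 x y = 0 → x = 0 ∨ y = 0) ↔
      a ∉ IntermediateField.fixedField (Subgroup.zpowers (σ ^ 2)) := by
  have hord : orderOf σ = 4 := by
    have : FiniteDimensional F K := Module.finite_of_finrank_pos (by omega)
    rw [orderOf_eq_card_of_forall_mem_zpowers hgen, IsGalois.card_aut_eq_finrank, hdeg]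
  have hσ4 (x : K) : σ (σ (σ (σ x))) = x := by
    have h : σ ^ 4 = 1 := hord ▸ pow_orderOf_eq_one σ
    simpa [pow_succ] using DFunLike.congr_fun h x
  constructor
  · intro hdiv hE
    have : FiniteDimensional F K := Module.finite_of_finrank_pos (by omega)
    have : Finite K := Module.finite_of_finite F
    obtain ⟨c, rfl⟩ := exists_mul_eq_of_mem_fixedField_zpowers
      (by rw [orderOf_pow, hord]; rfl) hE
    have h0 : petitMul σ (c * (σ ^ 2) c) 4 ![-((σ ^ 2) c), 0, 1, 0] ![c, 0, 1, 0] = 0 := by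
      simp only [petitMul_four_eq, petitShift_apply]
      ext i
      fin_cases i <;> simp [pow_two, mul_comm]
    rcases hdiv _ _ h0 with h | h <;> simpa using congrFun h 2
  · intro hE x y hxy
    have haσ : σ (σ a) ≠ a := by
      refine fun h => hE ?_
      have hle : Subgroup.zpowers (σ ^ 2) ≤ MulAction.stabilizer (K ≃ₐ[F] K) a := by
        rw [Subgroup.zpowers_le, MulAction.mem_stabilizer_iff]
        simpa [pow_two] using h
      exact (IntermediateField.mem_fixedField_iff _ _).2 fun τ hτ => hle hτ
    refine or_iff_not_imp_right.2 fun hy => ?_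
    rw [petitMul_four_eq] at hxy
    obtain ⟨h0, h1, h2, h3⟩ := eq_zero_of_petitShift_relation (σ : K ≃+* K) hσ4 haσ hy hxy
    ext i
    fin_cases i <;> assumption
end

section
/- Let q be an odd prime power, let c ∈ 𝔽_q^× be a non-square, let 𝔽_{q²} = 𝔽_q(√c), and let σ be the nontrivial element of Gal(𝔽_{q²}/𝔽_q). Then: (a) for every a ∈ 𝔽_{q²} ∖ 𝔽_q there exists u ∈ 𝔽_q such that the nonassociative quaternion algebras (𝔽_{q²}/𝔽_q, σ, a) and (𝔽_{q²}/𝔽_q, σ, u + √c) are isomorphic as 𝔽_q-algebras; and (b) for u, u′ ∈ 𝔽_q, the algebras (𝔽_{q²}/𝔽_q, σ, u + √c) and (𝔽_{q²}/𝔽_q, σ, u′ + √c) are isomorphic if and only if u′ = u or u′ = −u. -/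
theorem petitMul_two {F K : Type*} [Field F] [Field K] [Algebra F K]
    (σ : K ≃ₐ[F] K) (a : K) (x y : Fin 2 → K) :
    petitMul σ a 2 x y =
      ![x 0 * y 0 + x 1 * σ (y 1) * a, x 0 * y 1 + x 1 * σ (y 0)] := by
  ext l
  fin_cases l <;> simp [petitMul, Fin.sum_univ_two]

/-- If `τ` commutes with `σ` and `τ a = b * k * σ k`, then `x₀ + x₁ t ↦ τ x₀ + τ x₁ k t` is an
isomorphism. -/
theorem petitIso_two_of_apply_eq {F K : Type*} [Field F] [Field K] [Algebra F K]
    (σ τ : K ≃ₐ[F] K) (hcomm : ∀ x, τ (σ x) = σ (τ x)) {a b k : K} (hk : k ≠ 0)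
    (h : τ a = b * (k * σ k)) : PetitIso σ σ a b 2 := by
  refine ⟨{ toFun := fun x => ![τ (x 0), τ (x 1) * k]
            invFun := fun y => ![τ.symm (y 0), τ.symm (y 1 * k⁻¹)]
            map_add' := fun x y => ?_
            map_smul' := fun s x => ?_
            left_inv := fun x => ?_
            right_inv := fun y => ?_ }, fun x y => ?_⟩
  · ext i
    fin_cases i <;> simp [add_mul]
  · ext i
    fin_cases i <;> simp
  · ext i
    fin_cases i <;> simp [hk]
  · ext i
    fin_cases i <;> simp [hk]
  · rw [petitMul_two, petitMul_two]
    ext i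
    fin_cases i
    · change τ (x 0 * y 0 + x 1 * σ (y 1) * a) =
        τ (x 0) * τ (y 0) + τ (x 1) * k * σ (τ (y 1) * k) * b
      simp only [map_add, map_mul, h, hcomm]
      ring
    · change τ (x 0 * y 1 + x 1 * σ (y 0)) * k =
        τ (x 0) * (τ (y 1) * k) + τ (x 1) * k * σ (τ (y 0))
      simp only [map_add, map_mul, hcomm]
      ring

section Quadratic

variable {F K : Type*} [Field F] [Field K] [Algebra F K] {c : F} {r : K}

theorem algebraMap_ne_of_sq_eq (hc : ¬ ∃ d : F, d ^ 2 = c) (hr : r ^ 2 = algebraMap F K c)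
    (x : F) : algebraMap F K x ≠ r := by
  rintro rfl
  exact hc ⟨x, (algebraMap F K).injective (by rw [map_pow, hr])⟩

theorem algebraMap_add_mul_inj (hc : ¬ ∃ d : F, d ^ 2 = c) (hr : r ^ 2 = algebraMap F K c)
    {x y x' y' : F}
    (h : algebraMap F K x + algebraMap F K y * r = algebraMap F K x' + algebraMap F K y' * r) :
    x = x' ∧ y = y' := by
  have hy : y = y' := by
    by_contra hne
    have hne' : algebraMap F K y - algebraMap F K y' ≠ 0 := fun h0 =>
      hne ((algebraMap F K).injective (sub_eq_zero.mp h0))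
    refine algebraMap_ne_of_sq_eq hc hr ((x' - x) / (y - y')) ?_
    rw [map_div₀, map_sub, map_sub, div_eq_iff hne']
    linear_combination -h
  subst hy
  exact ⟨(algebraMap F K).injective (add_right_cancel h), rfl⟩

theorem exists_eq_algebraMap_add_mul (hc : ¬ ∃ d : F, d ^ 2 = c)
    (hr : r ^ 2 = algebraMap F K c) (hdeg : Module.finrank F K = 2) (z : K) :
    ∃ x y : F, z = algebraMap F K x + algebraMap F K y * r := by
  have hli : LinearIndependent F ![(1 : K), r] := by
    rw [LinearIndependent.pair_iff]
    intro s t hst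
    apply algebraMap_add_mul_inj hc hr
    simpa [Algebra.smul_def] using hst
  have hspan := hli.span_eq_top_of_card_eq_finrank (by simp [hdeg])
  have hz : z ∈ Submodule.span F (Set.range ![(1 : K), r]) := hspan ▸ Submodule.mem_top
  rw [Matrix.range_cons, Matrix.range_cons, Matrix.range_empty, Set.union_empty,
    Set.singleton_union, Submodule.mem_span_pair] at hz
  obtain ⟨x, y, rfl⟩ := hz
  exact ⟨x, y, by simp [Algebra.smul_def]⟩

theorem apply_eq_neg_of_ne_one (hc : ¬ ∃ d : F, d ^ 2 = c)
    (hr : r ^ 2 = algebraMap F K c) (hdeg : Module.finrank F K = 2)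
    {σ : K ≃ₐ[F] K} (hσ : σ ≠ 1) : σ r = -r := by
  have h : σ r ^ 2 = r ^ 2 := by rw [← map_pow, hr, AlgEquiv.commutes]
  refine (sq_eq_sq_iff_eq_or_eq_neg.mp h).resolve_left fun h1 => hσ ?_
  ext z
  obtain ⟨x, y, rfl⟩ := exists_eq_algebraMap_add_mul hc hr hdeg z
  simp [h1]

theorem mul_apply_eq_algebraMap {σ : K ≃ₐ[F] K} (hr : r ^ 2 = algebraMap F K c)
    (hσr : σ r = -r) (x y : F) :
    (algebraMap F K x + algebraMap F K y * r) * σ (algebraMap F K x + algebraMap F K y * r) =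
      algebraMap F K (x ^ 2 - c * y ^ 2) := by
  simp only [map_add, map_mul, AlgEquiv.commutes, hσr, map_sub, map_pow]
  linear_combination -(algebraMap F K y) ^ 2 * hr

/-- Over a finite field of odd order, the norm of a quadratic extension is surjective. -/
theorem exists_mul_apply_eq_algebraMap [Fintype F] (hF : Fintype.card F % 2 = 1) (hc0 : c ≠ 0)
    {σ : K ≃ₐ[F] K} (hr : r ^ 2 = algebraMap F K c) (hσr : σ r = -r) (v : F) :
    ∃ k : K, k * σ k = algebraMap F K v := by
  obtain ⟨x, y, hxy⟩ := FiniteField.exists_root_sum_quadratic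
    (f := Polynomial.X ^ 2) (g := Polynomial.C (-c) * Polynomial.X ^ 2 + Polynomial.C (-v))
    (Polynomial.degree_X_pow 2) (by compute_degree!) hF
  refine ⟨_, (mul_apply_eq_algebraMap hr hσr x y).trans (congrArg _ ?_)⟩
  simp only [Polynomial.eval_add, Polynomial.eval_mul, Polynomial.eval_pow, Polynomial.eval_X,
    Polynomial.eval_C] at hxy
  linear_combination hxy

/-- An isomorphism between two nonassociative quaternion algebras maps the unit to the unit. -/
theorem petitMul_two_map_one {σ : K ≃ₐ[F] K} {a b : K} (e : (Fin 2 → K) ≃ₗ[F] (Fin 2 → K))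
    (he : ∀ x y, e (petitMul σ a 2 x y) = petitMul σ b 2 (e x) (e y)) :
    e ![1, 0] = ![1, 0] := by
  have h := he ![1, 0] (e.symm ![1, 0])
  have h1 : petitMul σ a 2 ![1, 0] (e.symm ![1, 0]) = e.symm ![1, 0] := by
    rw [petitMul_two]
    ext i
    fin_cases i <;> simp
  have h2 : petitMul σ b 2 (e ![1, 0]) ![1, 0] = e ![1, 0] := by
    rw [petitMul_two]
    ext i
    fin_cases i <;> simp
  rw [h1, LinearEquiv.apply_symm_apply, h2] at h
  exact h.symm

/-- A square root of `c` in a nonassociative quaternion algebra `(K/F,σ,b)` lies in `K`. -/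
theorem eq_zero_of_petitMul_two_self (h2 : (2 : F) ≠ 0) (hc : ¬ ∃ d : F, d ^ 2 = c)
    (hr : r ^ 2 = algebraMap F K c) (hdeg : Module.finrank F K = 2) {σ : K ≃ₐ[F] K}
    (hσr : σ r = -r) {b : K} (hb : b ∉ Set.range (algebraMap F K)) {w : Fin 2 → K}
    (hw : petitMul σ b 2 w w = ![algebraMap F K c, 0]) : w 1 = 0 := by
  rw [petitMul_two] at hw
  have h0 : w 0 * w 0 + w 1 * σ (w 1) * b = algebraMap F K c := congrFun hw 0
  have h1 : w 0 * w 1 + w 1 * σ (w 0) = 0 := congrFun hw 1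
  by_contra hne
  have htr : w 0 + σ (w 0) = 0 := by
    apply mul_left_cancel₀ hne
    linear_combination h1
  obtain ⟨x, y, hxy⟩ := exists_eq_algebraMap_add_mul hc hr hdeg (w 0)
  obtain ⟨x', y', hxy'⟩ := exists_eq_algebraMap_add_mul hc hr hdeg (w 1)
  have hn := mul_apply_eq_algebraMap hr hσr x' y'
  rw [← hxy'] at hn
  have hx : x = 0 := by
    rw [hxy] at htr
    simp only [map_add, map_mul, AlgEquiv.commutes, hσr] at htr
    have h3 : algebraMap F K (2 * x) = 0 := by
      rw [map_mul, map_ofNat]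
      linear_combination htr
    simpa [h2] using h3
  have hn0 : w 1 * σ (w 1) ≠ 0 := mul_ne_zero hne (by simpa using hne)
  rw [hn] at h0 hn0
  refine hb ⟨(c - c * y ^ 2) / (x' ^ 2 - c * y' ^ 2), ?_⟩
  rw [map_div₀, div_eq_iff hn0]
  rw [hxy, hx, map_zero] at h0
  rw [map_sub, map_mul, map_pow]
  linear_combination -h0 + (algebraMap F K y) ^ 2 * hr

theorem eq_or_eq_neg_of_petitIso_two (h2 : (2 : F) ≠ 0) (hc : ¬ ∃ d : F, d ^ 2 = c)
    (hr : r ^ 2 = algebraMap F K c) (hdeg : Module.finrank F K = 2) {σ : K ≃ₐ[F] K}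
    (hσr : σ r = -r) {u u' : F}
    (h : PetitIso σ σ (algebraMap F K u + r) (algebraMap F K u' + r) 2) :
    u' = u ∨ u' = -u := by
  obtain ⟨e, he⟩ := h
  have hone := petitMul_two_map_one e he
  have hF : ∀ x : F, e ![algebraMap F K x, 0] = ![algebraMap F K x, 0] := by
    intro x
    have hx : (![algebraMap F K x, 0] : Fin 2 → K) = x • ![1, 0] := by
      ext i
      fin_cases i <;> simp [Algebra.smul_def]
    rw [hx, map_smul, hone]
  have hr0 : r ≠ 0 := fun h0 => algebraMap_ne_of_sq_eq hc hr 0 (by rw [h0, map_zero])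
  have hb : algebraMap F K u' + r ∉ Set.range (algebraMap F K) := by
    rintro ⟨x, hx⟩
    refine algebraMap_ne_of_sq_eq hc hr (x - u') ?_
    rw [map_sub, hx]
    ring
  have hsq : petitMul σ (algebraMap F K u' + r) 2 (e ![r, 0]) (e ![r, 0]) =
      ![algebraMap F K c, 0] := by
    rw [← he, petitMul_two, ← hF c]
    congr 1
    ext i
    fin_cases i <;> simp [← hr, sq]
  have hw1 := eq_zero_of_petitMul_two_self h2 hc hr hdeg hσr hb hsq
  obtain ⟨s, hs, her⟩ : ∃ s : F, s ^ 2 = 1 ∧ e ![r, 0] = ![algebraMap F K s * r, 0] := by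
    rw [petitMul_two] at hsq
    have h0 := congrFun hsq 0
    simp only [hw1, Matrix.cons_val_zero, zero_mul, add_zero, ← hr, ← sq] at h0
    rcases sq_eq_sq_iff_eq_or_eq_neg.mp h0 with h0 | h0
    · refine ⟨1, one_pow 2, ?_⟩
      ext i
      fin_cases i <;> simp [hw1, h0]
    · refine ⟨-1, by norm_num, ?_⟩
      ext i
      fin_cases i <;> simp [hw1, h0]
  have hs0 : algebraMap F K s ≠ 0 := by
    rw [Ne, map_eq_zero]
    rintro rfl
    simp at hs
  have h2K : (2 : K) ≠ 0 := by
    rw [← map_ofNat (algebraMap F K) 2]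
    simpa using h2
  have ht0 : e ![0, 1] 0 = 0 := by
    have hanti : petitMul σ (algebraMap F K u + r) 2 ![0, 1] ![r, 0] =
        -petitMul σ (algebraMap F K u + r) 2 ![r, 0] ![0, 1] := by
      rw [petitMul_two, petitMul_two]
      ext i
      fin_cases i <;> simp [hσr]
    have h3 := congrArg e hanti
    rw [map_neg, he, he, her, petitMul_two, petitMul_two] at h3
    have h4 := congrFun h3 0
    simp only [Matrix.cons_val_zero, Matrix.cons_val_one, Pi.neg_apply, map_zero, mul_zero,
      zero_mul, add_zero] at h4
    have h5 : (2 * (algebraMap F K s * r)) * e ![0, 1] 0 = 0 := by linear_combination h4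
    exact (mul_eq_zero.mp h5).resolve_left (mul_ne_zero h2K (mul_ne_zero hs0 hr0))
  obtain ⟨x, y, hxy⟩ := exists_eq_algebraMap_add_mul hc hr hdeg (e ![0, 1] 1)
  have hn := mul_apply_eq_algebraMap hr hσr x y
  rw [← hxy] at hn
  set n := x ^ 2 - c * y ^ 2
  have ht : petitMul σ (algebraMap F K u + r) 2 ![0, 1] ![0, 1] =
      ![algebraMap F K u, 0] + ![r, 0] := by
    rw [petitMul_two]
    ext i
    fin_cases i <;> simp
  have h6 := congrArg e ht
  rw [map_add, he, hF, her, petitMul_two] at h6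
  have h7 := congrFun h6 0
  simp only [Matrix.cons_val_zero, Pi.add_apply, ht0, hn, zero_mul, zero_add] at h7
  obtain ⟨hu, hns⟩ := algebraMap_add_mul_inj (x := n * u') (y := n) (x' := u) (y' := s) hc hr
    (by rw [← h7, map_mul]; ring)
  rw [hns] at hu
  rcases sq_eq_one_iff.mp hs with rfl | rfl
  · left
    linear_combination hu
  · right
    linear_combination -hu

end Quadratic

/-- Let `q` be an odd prime power, `c ∈ 𝔽_q^×` a non-square,
`𝔽_{q²} = 𝔽_q(√c)`, and `σ` the nontrivial element of `Gal(𝔽_{q²}/𝔽_q)`. Then: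
(a) every nonassociative quaternion algebra `(𝔽_{q²}/𝔽_q, σ, a)` with
`a ∈ 𝔽_{q²} ∖ 𝔽_q` is isomorphic to one with `a = u + √c`, `u ∈ 𝔽_q`; and
(b) `(𝔽_{q²}/𝔽_q, σ, u + √c) ≅ (𝔽_{q²}/𝔽_q, σ, u' + √c)` iff `u' = u` or
`u' = -u`. -/
theorem stmt_16 {F K : Type*} [Field F] [Fintype F] [Field K] [Algebra F K]
    [IsGalois F K]
    (q : ℕ) (hq : IsPrimePow q) (hqodd : Odd q) (hcard : Fintype.card F = q)
    (c : F) (hc0 : c ≠ 0) (hc : ¬ ∃ d : F, d ^ 2 = c)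
    (hdeg : Module.finrank F K = 2)
    (r : K) (hr : r ^ 2 = algebraMap F K c)
    (σ : K ≃ₐ[F] K) (hσ : σ ≠ 1) :
    (∀ a : K, a ∉ Set.range (algebraMap F K) →
      ∃ u : F, PetitIso σ σ a (algebraMap F K u + r) 2) ∧
    (∀ u u' : F,
      PetitIso σ σ (algebraMap F K u + r) (algebraMap F K u' + r) 2 ↔
        (u' = u ∨ u' = -u)) := by
  have hF : Fintype.card F % 2 = 1 := by rwa [hcard, ← Nat.odd_iff]
  have h2 : (2 : F) ≠ 0 := Ring.two_ne_zero fun h => by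
    rw [FiniteField.even_card_iff_char_two] at h
    omega
  have hσr := apply_eq_neg_of_ne_one hc hr hdeg hσ
  have hne : ∀ {v : F} {k : K}, v ≠ 0 → k * σ k = algebraMap F K v → k ≠ 0 := by
    rintro v k hv hk rfl
    rw [zero_mul, eq_comm, map_eq_zero] at hk
    exact hv hk
  refine ⟨fun a ha => ?_, fun u u' => ⟨eq_or_eq_neg_of_petitIso_two h2 hc hr hdeg hσr, ?_⟩⟩
  · obtain ⟨x, y, rfl⟩ := exists_eq_algebraMap_add_mul hc hr hdeg a
    have hy : y ≠ 0 := by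
      rintro rfl
      exact ha ⟨x, by simp⟩
    obtain ⟨k, hk⟩ := exists_mul_apply_eq_algebraMap hF hc0 hr hσr y
    refine ⟨x / y, petitIso_two_of_apply_eq σ 1 (fun _ => rfl) (hne hy hk) ?_⟩
    have hy' : algebraMap F K y ≠ 0 := by simpa using hy
    rw [hk, AlgEquiv.one_apply, map_div₀]
    field_simp
  · rintro (rfl | rfl)
    · exact petitIso_two_of_apply_eq σ 1 (fun _ => rfl) one_ne_zero (by simp)
    · obtain ⟨k, hk⟩ := exists_mul_apply_eq_algebraMap hF hc0 hr hσr (-1)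
      refine petitIso_two_of_apply_eq σ σ (fun _ => rfl) (hne (neg_ne_zero.mpr one_ne_zero) hk) ?_
      rw [hk, map_add, AlgEquiv.commutes, hσr]
      simp [add_comm]
end

section
/- Let K/F be a cyclic Galois field extension of degree n ≥ 3, let σ₁ and σ₂ be distinct generators of Gal(K/F), and let m ≥ 2 with n ≥ m−1. Let f(t) = t^m − Σ_{i=0}^{m−1} a_i t^i ∈ K[t;σ₁] with a_i ∈ K ∖ F for all 0 ≤ i ≤ m−1, and let g(t) = t^m − b ∈ K[t;σ₂] with b ∈ K ∖ F, and assume f is not right-invariant (g is not right-invariant since b ∉ F). Then the Petit algebras S_f (formed in K[t;σ₁]) and S_g (formed in K[t;σ₂]) are not isomorphic as F-algebras. -/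
/-- Multiplication of the twisted polynomial ring `K[t;σ]`, on the space
`ℕ →₀ K` of finitely supported coefficient sequences: determined by
`t·c = σ(c)·t`, i.e. `(a t^i)(b t^j) = a σ^i(b) t^{i+j}`. -/
noncomputable def tmul {F K : Type*} [Field F] [Field K] [Algebra F K]
    (σ : K ≃ₐ[F] K) (p q : ℕ →₀ K) : ℕ →₀ K :=
  p.sum fun i a => q.sum fun j b => Finsupp.single (i + j) (a * (σ ^ i) b)

/-- The twisted polynomial `p` has degree `< m`. -/
def DegLt {K : Type*} [Field K] (m : ℕ) (p : ℕ →₀ K) : Prop :=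
  ∀ i : ℕ, m ≤ i → p i = 0

/-- The twisted polynomial `p` is monic of degree `m`. -/
def TMonic {K : Type*} [Field K] (m : ℕ) (p : ℕ →₀ K) : Prop :=
  p m = 1 ∧ ∀ i : ℕ, m < i → p i = 0

/-- `f` is right-invariant: the left ideal `K[t;σ]f` is a two-sided ideal,
i.e. it is closed under right multiplication. -/
def RightInvariant {F K : Type*} [Field F] [Field K] [Algebra F K]
    (σ : K ≃ₐ[F] K) (f : ℕ →₀ K) : Prop :=
  ∀ q g : ℕ →₀ K, ∃ q' : ℕ →₀ K, tmul σ (tmul σ q f) g = tmul σ q' f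

/-- `mul` is the multiplication of the Petit algebra
`S_f = K[t;σ]/K[t;σ]f` on polynomials of degree `< m`:
`mul p q` is the remainder of `p·q` after right division by `f`. -/
def IsPetitMul {F K : Type*} [Field F] [Field K] [Algebra F K]
    (σ : K ≃ₐ[F] K) (m : ℕ) (f : ℕ →₀ K)
    (mul : (ℕ →₀ K) → (ℕ →₀ K) → (ℕ →₀ K)) : Prop :=
  ∀ p q : ℕ →₀ K, DegLt m p → DegLt m q →
    DegLt m (mul p q) ∧ ∃ s : ℕ →₀ K, tmul σ p q = tmul σ s f + mul p q


section TwistedPolynomial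

open Finsupp

variable {F K : Type*} [Field F] [Field K] [Algebra F K] (σ : K ≃ₐ[F] K)

theorem tmul_single_single (i j : ℕ) (a b : K) :
    tmul σ (single i a) (single j b) = single (i + j) (a * (σ ^ i) b) := by
  simp [tmul]

theorem tmul_add_left (p p' q : ℕ →₀ K) : tmul σ (p + p') q = tmul σ p q + tmul σ p' q := by
  unfold tmul
  rw [Finsupp.sum_add_index']
  · simp
  · intro i a a'
    simp [add_mul, Finsupp.sum_add]

theorem tmul_add_right (p q q' : ℕ →₀ K) : tmul σ p (q + q') = tmul σ p q + tmul σ p q' := by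
  unfold tmul
  rw [← Finsupp.sum_add]
  refine Finsupp.sum_congr fun i _ => ?_
  rw [Finsupp.sum_add_index']
  · simp
  · simp [mul_add]

theorem tmul_sub_left (p p' q : ℕ →₀ K) : tmul σ (p - p') q = tmul σ p q - tmul σ p' q := by
  rw [eq_sub_iff_add_eq, ← tmul_add_left, sub_add_cancel]

theorem tmul_sub_right (p q q' : ℕ →₀ K) : tmul σ p (q - q') = tmul σ p q - tmul σ p q' := by
  rw [eq_sub_iff_add_eq, ← tmul_add_right, sub_add_cancel]

theorem tmul_zero_left (q : ℕ →₀ K) : tmul σ 0 q = 0 := by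
  simp [tmul]

theorem tmul_zero_right (p : ℕ →₀ K) : tmul σ p 0 = 0 := by
  simp [tmul]

theorem tmul_single_right_apply (p : ℕ →₀ K) (j : ℕ) (b : K) (k : ℕ) :
    tmul σ p (single j b) k = if j ≤ k then p (k - j) * (σ ^ (k - j)) b else 0 := by
  induction p using Finsupp.induction_linear with
  | zero => simp [tmul_zero_left]
  | add p q hp hq =>
    rw [tmul_add_left, Finsupp.add_apply, hp, hq]
    split_ifs <;> simp [add_mul]
  | single i a =>
    rw [tmul_single_single, Finsupp.single_apply]
    by_cases h : i + j = k
    · subst h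
      simp
    · rw [if_neg h]
      split_ifs with hj
      · rw [Finsupp.single_eq_of_ne (by omega), zero_mul]
      · rfl

theorem tmul_single_zero_left (c : K) (p : ℕ →₀ K) : tmul σ (single 0 c) p = c • p := by
  induction p using Finsupp.induction_linear with
  | zero => simp [tmul_zero_right]
  | add p q hp hq => rw [tmul_add_right, hp, hq, smul_add]
  | single i a => simp [tmul_single_single]

theorem tmul_smul_left (c : K) (p q : ℕ →₀ K) : tmul σ (c • p) q = c • tmul σ p q := by
  induction p using Finsupp.induction_linear with
  | zero => simp [tmul_zero_left]
  | add p p' hp hp' => rw [smul_add, tmul_add_left, hp, hp', tmul_add_left, smul_add]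
  | single i a =>
    induction q using Finsupp.induction_linear with
    | zero => simp [tmul_zero_right]
    | add q q' hq hq' => rw [tmul_add_right, hq, hq', tmul_add_right, smul_add]
    | single j b =>
      rw [smul_single, smul_eq_mul, tmul_single_single, tmul_single_single, smul_single,
        smul_eq_mul, mul_assoc]

theorem tmul_apply_eq_zero {p q : ℕ →₀ K} {d m k : ℕ} (hp : ∀ i, d < i → p i = 0)
    (hq : DegLt m q) (hk : d + m ≤ k) : tmul σ p q k = 0 := by
  unfold tmul
  rw [Finsupp.sum_apply]
  refine Finset.sum_eq_zero fun i hi => ?_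
  beta_reduce
  rw [Finsupp.sum_apply]
  refine Finset.sum_eq_zero fun j hj => ?_
  have hi' : i ≤ d := by
    by_contra! h
    exact (Finsupp.mem_support_iff.1 hi) (hp i h)
  have hj' : j < m := by
    by_contra! h
    exact (Finsupp.mem_support_iff.1 hj) (hq j h)
  exact Finsupp.single_eq_of_ne (by omega)

theorem DegLt.single {m i : ℕ} (h : i < m) (a : K) : DegLt m (Finsupp.single i a) :=
  fun _ hj => Finsupp.single_eq_of_ne (by omega)

theorem DegLt.add {m : ℕ} {p q : ℕ →₀ K} (hp : DegLt m p) (hq : DegLt m q) :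
    DegLt m (p + q) := fun i hi => by simp [hp i hi, hq i hi]

theorem DegLt.sub {m : ℕ} {p q : ℕ →₀ K} (hp : DegLt m p) (hq : DegLt m q) :
    DegLt m (p - q) := fun i hi => by simp [hp i hi, hq i hi]

theorem DegLt.smul {m : ℕ} {p : ℕ →₀ K} (c : K) (hp : DegLt m p) :
    DegLt m (c • p) := fun i hi => by simp [hp i hi]

theorem DegLt.sum_single {m : ℕ} (a : Fin m → K) :
    DegLt m (∑ i : Fin m, Finsupp.single (i : ℕ) (a i)) := by
  intro j hj
  rw [Finsupp.finsetSum_apply]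
  exact Finset.sum_eq_zero fun i _ => DegLt.single i.2 _ j hj

/-- A left multiple of a monic polynomial of degree `m` that has degree `< m` is trivial. -/
theorem eq_zero_of_degLt_tmul {m : ℕ} {l s : ℕ →₀ K} (hl : DegLt m l)
    (h : DegLt m (tmul σ s (single m 1 - l))) : s = 0 := by
  by_contra hs
  have hne : s.support.Nonempty := Finsupp.support_nonempty_iff.2 hs
  set d := s.support.max' hne
  have hd : s d ≠ 0 := Finsupp.mem_support_iff.1 (s.support.max'_mem hne)
  have hgt : ∀ i, d < i → s i = 0 := fun i hi => by
    by_contra h0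
    exact absurd (s.support.le_max' i (Finsupp.mem_support_iff.2 h0)) (not_le.2 hi)
  have h1 := h (d + m) (by omega)
  rw [tmul_sub_right, Finsupp.sub_apply, tmul_apply_eq_zero σ hgt hl le_rfl,
    tmul_single_right_apply] at h1
  simp at h1
  exact hd h1

theorem IsPetitMul.eq_of_tmul_eq {σ : K ≃ₐ[F] K} {m : ℕ} {l : ℕ →₀ K}
    {mul : (ℕ →₀ K) → (ℕ →₀ K) → (ℕ →₀ K)} (hmul : IsPetitMul σ m (single m 1 - l) mul)
    (hl : DegLt m l) {p q s r : ℕ →₀ K} (hp : DegLt m p) (hq : DegLt m q) (hr : DegLt m r)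
    (h : tmul σ p q = tmul σ s (single m 1 - l) + r) : mul p q = r := by
  obtain ⟨hdeg, s', hs'⟩ := hmul p q hp hq
  have hdiff : tmul σ (s - s') (single m 1 - l) = mul p q - r := by
    rw [tmul_sub_left, sub_eq_sub_iff_add_eq_add, ← h, hs', add_comm]
  have h0 := eq_zero_of_degLt_tmul σ hl (hdiff ▸ hdeg.sub hr)
  rw [h0, tmul_zero_left] at hdiff
  exact sub_eq_zero.1 hdiff.symm

theorem IsPetitMul.eq_tmul {σ : K ≃ₐ[F] K} {m : ℕ} {l : ℕ →₀ K}
    {mul : (ℕ →₀ K) → (ℕ →₀ K) → (ℕ →₀ K)} (hmul : IsPetitMul σ m (single m 1 - l) mul)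
    (hl : DegLt m l) {p q : ℕ →₀ K} (hp : DegLt m p) (hq : DegLt m q)
    (hr : DegLt m (tmul σ p q)) : mul p q = tmul σ p q :=
  hmul.eq_of_tmul_eq hl (s := 0) hp hq hr (by rw [tmul_zero_left, zero_add])

theorem IsPetitMul.single_zero_left {σ : K ≃ₐ[F] K} {m : ℕ} (hm : 0 < m) {l : ℕ →₀ K}
    {mul : (ℕ →₀ K) → (ℕ →₀ K) → (ℕ →₀ K)} (hmul : IsPetitMul σ m (single m 1 - l) mul)
    (hl : DegLt m l) (c : K) {p : ℕ →₀ K} (hp : DegLt m p) :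
    mul (single 0 c) p = c • p := by
  rw [hmul.eq_tmul hl (.single hm c) hp] <;> rw [tmul_single_zero_left]
  exact hp.smul c

theorem IsPetitMul.smul_left {σ : K ≃ₐ[F] K} {m : ℕ} {l : ℕ →₀ K}
    {mul : (ℕ →₀ K) → (ℕ →₀ K) → (ℕ →₀ K)} (hmul : IsPetitMul σ m (single m 1 - l) mul)
    (hl : DegLt m l) (c : K) {p q : ℕ →₀ K} (hp : DegLt m p) (hq : DegLt m q) :
    mul (c • p) q = c • mul p q := by
  obtain ⟨hdeg, s, hs⟩ := hmul p q hp hq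
  refine hmul.eq_of_tmul_eq hl (s := c • s) (hp.smul c) hq (hdeg.smul c) ?_
  rw [tmul_smul_left, tmul_smul_left, hs, smul_add]

theorem IsPetitMul.single_zero_right {σ : K ≃ₐ[F] K} {m : ℕ} (hm : 0 < m) {l : ℕ →₀ K}
    {mul : (ℕ →₀ K) → (ℕ →₀ K) → (ℕ →₀ K)} (hmul : IsPetitMul σ m (single m 1 - l) mul)
    (hl : DegLt m l) (c : K) {p : ℕ →₀ K} (hp : DegLt m p) (i : ℕ) :
    mul p (single 0 c) i = p i * (σ ^ i) c := by
  rw [hmul.eq_tmul hl hp (.single hm c)]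
  · simp [tmul_single_right_apply]
  · intro j hj
    simp [tmul_single_right_apply, hp j hj]

/-- Monomials multiply to monomials in the Petit algebra of `t^m - b`. -/
theorem IsPetitMul.exists_single_mul_single {σ : K ≃ₐ[F] K} {m : ℕ} {b : K}
    {mul : (ℕ →₀ K) → (ℕ →₀ K) → (ℕ →₀ K)}
    (hmul : IsPetitMul σ m (single m 1 - single 0 b) mul)
    {i j : ℕ} (hi : i < m) (hj : j < m) (c d : K) :
    ∃ e : K, mul (single i c) (single j d) = single ((i + j) % m) e := by
  have hl : DegLt m (single 0 b) := .single (by omega) b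
  rcases lt_or_ge (i + j) m with h | h
  · refine ⟨c * (σ ^ i) d, ?_⟩
    rw [hmul.eq_tmul hl (.single hi c) (.single hj d)] <;> rw [tmul_single_single]
    · rw [Nat.mod_eq_of_lt h]
    · exact .single h _
  · have hmod : (i + j) % m = i + j - m := by
      rw [Nat.mod_eq_sub_mod h, Nat.mod_eq_of_lt (by omega)]
    rw [hmod]
    refine ⟨c * (σ ^ i) d * (σ ^ (i + j - m)) b,
      hmul.eq_of_tmul_eq hl (s := single (i + j - m) (c * (σ ^ i) d)) (.single hi c)
        (.single hj d) (.single (by omega) _) ?_⟩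
    rw [tmul_sub_right, tmul_single_single, tmul_single_single, tmul_single_single, map_one,
      mul_one, Nat.sub_add_cancel h, add_zero, sub_add_cancel]

/-- If `σ b ≠ b`, an element of the Petit algebra of `t^m - b` which associates on the left with
`t^(m-1)` and `t` is a constant. -/
theorem IsPetitMul.eq_single_zero_of_assoc {σ : K ≃ₐ[F] K} {m : ℕ} (hm : 2 ≤ m) {b : K}
    (hb : σ b ≠ b) {mul : (ℕ →₀ K) → (ℕ →₀ K) → (ℕ →₀ K)}
    (hmul : IsPetitMul σ m (single m 1 - single 0 b) mul) {x : ℕ →₀ K} (hx : DegLt m x)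
    (h : mul (mul x (single (m - 1) 1)) (single 1 1) =
      mul x (mul (single (m - 1) 1) (single 1 1))) :
    x = single 0 (x 0) := by
  have hl : DegLt m (single 0 b) := .single (by omega) b
  have ht : DegLt m (single 1 (1 : K)) := .single (by omega) 1
  have ht' : DegLt m (single (m - 1) (1 : K)) := .single (by omega) 1
  have h1 : mul (single (m - 1) 1) (single 1 1) = single 0 b := by
    refine hmul.eq_of_tmul_eq hl (s := single 0 1) ht' ht hl ?_
    rw [tmul_single_zero_left, tmul_single_single, Nat.sub_add_cancel (by omega)]
    simp
  set s : ℕ →₀ K := x.comapDomain (fun i => i + 1) (add_left_injective 1).injOn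
  have hs : ∀ i, s i = x (i + 1) := fun i => rfl
  set r : ℕ →₀ K := single (m - 1) (x 0) + tmul σ s (single 0 b)
  have hr : DegLt m r := by
    refine (DegLt.single (by omega) _).add fun i hi => ?_
    simp [tmul_single_right_apply, hs, hx (i + 1) (by omega)]
  have h2 : mul x (single (m - 1) 1) = r := by
    refine hmul.eq_of_tmul_eq hl (s := s) hx ht' hr ?_
    have hdecomp : tmul σ x (single (m - 1) 1) =
        single (m - 1) (x 0) + tmul σ s (single m 1) := by
      ext k
      simp only [Finsupp.add_apply, tmul_single_right_apply, hs, map_one, mul_one]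
      rcases lt_trichotomy k (m - 1) with hk | rfl | hk
      · rw [if_neg (by omega), if_neg (by omega), Finsupp.single_eq_of_ne (by omega), add_zero]
      · rw [if_pos le_rfl, if_neg (by omega)]
        simp
      · rw [if_pos (by omega), if_pos (by omega), Finsupp.single_eq_of_ne (by omega), zero_add,
          show k - m + 1 = k - (m - 1) by omega]
    rw [hdecomp, tmul_sub_right]
    simp only [r]
    abel
  set r' : ℕ →₀ K := single 0 (x 0 * b) + tmul σ (tmul σ s (single 0 b)) (single 1 1)
  have hr' : DegLt m r' := by
    refine (DegLt.single (by omega) _).add fun i hi => ?_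
    simp only [tmul_single_right_apply, hs]
    simp [show 1 ≤ i by omega, Nat.sub_add_cancel (show 1 ≤ i by omega), hx i hi]
  have h3 : mul r (single 1 1) = r' := by
    refine hmul.eq_of_tmul_eq hl (s := single 0 (x 0)) hr ht hr' ?_
    simp only [r, r', tmul_add_left, tmul_sub_right, tmul_single_single]
    rw [Nat.sub_add_cancel (by omega), pow_zero, AlgEquiv.one_apply, AlgEquiv.one_apply, map_one,
      mul_one, zero_add, zero_add]
    abel
  ext i
  cases i with
  | zero => simp
  | succ i =>
    rw [h1, h2, h3] at h
    have h4 := DFunLike.congr_fun h (i + 1)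
    rw [hmul.single_zero_right (by omega) hl b hx] at h4
    simp only [r', Finsupp.add_apply, tmul_single_right_apply, hs] at h4
    simp at h4
    rw [Finsupp.single_eq_of_ne (by omega)]
    rcases h4 with h4 | h4
    · exact absurd (σ.injective.iterate i h4).symm hb
    · exact h4

end TwistedPolynomial

/-- Let `K/F` be cyclic Galois of degree `n ≥ 3`, let
`σ₁ ≠ σ₂` be distinct generators of `Gal(K/F)`, and `m ≥ 2` with `n ≥ m-1`.
Let `f(t) = t^m - Σ_{i<m} a_i t^i ∈ K[t;σ₁]` with all `a_i ∈ K ∖ F`, not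
right-invariant, and `g(t) = t^m - b ∈ K[t;σ₂]` with `b ∈ K ∖ F`. Then the
Petit algebras `S_f` and `S_g` are not isomorphic as `F`-algebras. -/
theorem stmt_18 {F K : Type*} [Field F] [Field K] [Algebra F K]
    [IsGalois F K]
    (n : ℕ) (hdeg : Module.finrank F K = n) (hn : 3 ≤ n)
    (σ₁ σ₂ : K ≃ₐ[F] K)
    (hgen₁ : ∀ τ : K ≃ₐ[F] K, τ ∈ Subgroup.zpowers σ₁)
    (hgen₂ : ∀ τ : K ≃ₐ[F] K, τ ∈ Subgroup.zpowers σ₂)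
    (hne : σ₁ ≠ σ₂)
    (m : ℕ) (hm : 2 ≤ m) (hnm : m - 1 ≤ n)
    (a : Fin m → K) (ha : ∀ i : Fin m, a i ∉ Set.range (algebraMap F K))
    (b : K) (hb : b ∉ Set.range (algebraMap F K))
    (f g : ℕ →₀ K)
    (hfdef : f = Finsupp.single m 1 - ∑ i : Fin m, Finsupp.single (i : ℕ) (a i))
    (hgdef : g = Finsupp.single m 1 - Finsupp.single 0 b)
    (hfri : ¬ RightInvariant σ₁ f)
    (mul₁ mul₂ : (ℕ →₀ K) → (ℕ →₀ K) → (ℕ →₀ K))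
    (hmul₁ : IsPetitMul σ₁ m f mul₁) (hmul₂ : IsPetitMul σ₂ m g mul₂) :
    ¬ ∃ H : (ℕ →₀ K) →ₗ[F] (ℕ →₀ K),
      (∀ p : ℕ →₀ K, DegLt m p → DegLt m (H p)) ∧
      (∀ p q : ℕ →₀ K, DegLt m p → DegLt m q → H p = H q → p = q) ∧
      (∀ q : ℕ →₀ K, DegLt m q → ∃ p : ℕ →₀ K, DegLt m p ∧ H p = q) ∧
      (∀ p q : ℕ →₀ K, DegLt m p → DegLt m q →
        H (mul₁ p q) = mul₂ (H p) (H q)) := by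
  rintro ⟨H, hdegH, hinj, hsurj, hmulH⟩
  have : FiniteDimensional F K := Module.finite_of_finrank_pos (by omega)
  have hgen_fix : ∀ σ : K ≃ₐ[F] K, (∀ τ : K ≃ₐ[F] K, τ ∈ Subgroup.zpowers σ) → σ b ≠ b := by
    intro σ hσ h
    refine hb ((IsGalois.mem_range_algebraMap_iff_fixed b).2 fun τ => ?_)
    have hle : Subgroup.zpowers σ ≤ MulAction.stabilizer (K ≃ₐ[F] K) b :=
      Subgroup.zpowers_le.2 h
    exact hle (hσ τ)
  have hl₁ := DegLt.sum_single a
  have hl₂ : DegLt m (Finsupp.single 0 b) := .single (by omega) b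
  subst hfdef hgdef
  have hm0 : 0 < m := by omega
  have ht : DegLt m (Finsupp.single 1 (1 : K)) := .single (by omega) 1
  -- `H` maps the left nucleus `K` of the first algebra into that of the second.
  have hK : ∀ c, H (Finsupp.single 0 c) = Finsupp.single 0 (H (Finsupp.single 0 c) 0) := by
    intro c
    have hc : DegLt m (Finsupp.single 0 c) := .single hm0 c
    obtain ⟨p, hp, hpH⟩ := hsurj (Finsupp.single (m - 1) 1) (.single (by omega) 1)
    obtain ⟨q, hq, hqH⟩ := hsurj (Finsupp.single 1 1) ht
    refine hmul₂.eq_single_zero_of_assoc hm (hgen_fix σ₂ hgen₂) (hdegH _ hc) ?_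
    have hcp := (hmul₁ _ p hc hp).1
    have hpq := (hmul₁ p q hp hq).1
    rw [← hpH, ← hqH, ← hmulH _ _ hc hp, ← hmulH _ _ hcp hq, ← hmulH _ _ hp hq,
      ← hmulH _ _ hc hpq, hmul₁.single_zero_left hm0 hl₁ c hp,
      hmul₁.single_zero_left hm0 hl₁ c hpq, hmul₁.smul_left hl₁ c hp hq]
  let τ : K →ₗ[F] K := Finsupp.lapply 0 ∘ₗ H ∘ₗ Finsupp.lsingle 0
  have hτ : ∀ c, H (Finsupp.single 0 c) = Finsupp.single 0 (τ c) := hK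
  have hτinj : Function.Injective τ := fun c d hcd =>
    Finsupp.single_injective 0 (hinj _ _ (.single hm0 c) (.single hm0 d) (by rw [hτ, hτ, hcd]))
  have hτsurj : Function.Surjective τ := LinearMap.injective_iff_surjective.1 hτinj
  set u := H (Finsupp.single 1 1)
  have hu : DegLt m u := hdegH _ ht
  have hucoeff : ∀ i c, u i ≠ 0 → (σ₂ ^ i) (τ c) = τ (σ₁ c) := by
    intro i c hi
    have h1 : mul₁ (Finsupp.single 1 1) (Finsupp.single 0 c) =
        mul₁ (Finsupp.single 0 (σ₁ c)) (Finsupp.single 1 1) := by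
      rw [hmul₁.eq_tmul hl₁ ht (.single hm0 c), hmul₁.single_zero_left hm0 hl₁ _ ht,
        tmul_single_single]
      · simp
      · rw [tmul_single_single]
        exact .single (by omega) _
    have h2 := congrArg H h1
    rw [hmulH _ _ ht (.single hm0 c), hmulH _ _ (.single hm0 _) ht, hτ, hτ,
      hmul₂.single_zero_left hm0 hl₂ _ hu] at h2
    have h3 := DFunLike.congr_fun h2 i
    rw [hmul₂.single_zero_right hm0 hl₂ _ hu, Finsupp.smul_apply, smul_eq_mul, mul_comm] at h3
    exact mul_right_cancel₀ hi h3
  have hu0 : u 0 = 0 := by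
    by_contra h
    have h1 := hucoeff 0 b h
    exact hgen_fix σ₁ hgen₁ (hτinj h1).symm
  have horder : orderOf σ₂ = n := by
    rw [orderOf_eq_card_of_forall_mem_zpowers hgen₂, IsGalois.card_aut_eq_finrank, hdeg]
  have huniq : ∀ i j, i < j → u i ≠ 0 → u j ≠ 0 → False := by
    intro i j hij hi hj
    have hpow : σ₂ ^ i = σ₂ ^ j := by
      ext c
      obtain ⟨d, rfl⟩ := hτsurj c
      rw [hucoeff i d hi, hucoeff j d hj]
    have hi0 : i ≠ 0 := fun h => hi (h ▸ hu0)
    have hjm : j < m := by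
      by_contra! h
      exact hj (hu j h)
    rw [pow_eq_pow_iff_modEq, horder, Nat.modEq_iff_dvd' hij.le] at hpow
    have := Nat.le_of_dvd (by omega) hpow
    omega
  obtain ⟨i, hi, k, huk⟩ : ∃ i < m, ∃ k, u = Finsupp.single i k := by
    by_cases h : u = 0
    · exact ⟨0, hm0, 0, by simp [h]⟩
    · obtain ⟨i, hi⟩ := Finsupp.ne_iff.1 h
      refine ⟨i, ?_, u i, ?_⟩
      · by_contra! h'
        exact hi (hu i h')
      · ext j
        rcases eq_or_ne j i with rfl | hji
        · simp
        · rw [Finsupp.single_eq_of_ne hji]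
          by_contra hj
          rcases lt_or_gt_of_ne hji with hlt | hlt
          · exact huniq j i hlt hj hi
          · exact huniq i j hlt hi hj
  have hmul_t : ∀ j < m, (∃ c, H (Finsupp.single j 1) = Finsupp.single (i * j % m) c) →
      ∃ c, H (mul₁ (Finsupp.single 1 1) (Finsupp.single j 1)) =
        Finsupp.single (i * (j + 1) % m) c := by
    rintro j hj ⟨c, hc⟩
    obtain ⟨e, he⟩ := hmul₂.exists_single_mul_single hi (Nat.mod_lt (i * j) hm0) k c
    rw [Nat.add_mod_mod, add_comm i, ← mul_add_one] at he
    refine ⟨e, ?_⟩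
    rw [hmulH _ _ ht (.single hj 1), hc, ← he]
    exact congrArg (mul₂ · _) huk
  have hpow : ∀ j < m, ∃ c, H (Finsupp.single j 1) = Finsupp.single (i * j % m) c := by
    intro j
    induction j with
    | zero => exact fun _ => ⟨τ 1, by simpa using hτ 1⟩
    | succ j ih =>
      intro hj
      obtain ⟨c, hc⟩ := hmul_t j (by omega) (ih (by omega))
      refine ⟨c, ?_⟩
      rw [← hc, hmul₁.eq_tmul hl₁ ht (.single (by omega) 1)] <;> rw [tmul_single_single]
      · simp [add_comm]
      · exact .single (by omega) _
  obtain ⟨c, hc⟩ := hmul_t (m - 1) (by omega) (hpow (m - 1) (by omega))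
  have htop : mul₁ (Finsupp.single 1 1) (Finsupp.single (m - 1) 1) =
      ∑ i : Fin m, Finsupp.single (i : ℕ) (a i) := by
    refine hmul₁.eq_of_tmul_eq hl₁ (s := Finsupp.single 0 1) ht (.single (by omega) 1) hl₁ ?_
    rw [tmul_single_zero_left, tmul_single_single, one_smul, sub_add_cancel, map_one, one_mul,
      Nat.add_sub_cancel' (by omega)]
  rw [htop, Nat.sub_add_cancel (by omega), Nat.mul_mod_left] at hc
  obtain ⟨d, rfl⟩ := hτsurj c
  have hd := DFunLike.congr_fun (hinj _ _ hl₁ (.single hm0 d) (hc.trans (hτ d).symm)) 1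
  rw [Finsupp.finsetSum_apply, Finset.sum_eq_single (⟨1, by omega⟩ : Fin m)] at hd
  · refine ha ⟨1, by omega⟩ ⟨0, ?_⟩
    simpa using hd.symm
  · intro j _ hj
    exact Finsupp.single_eq_of_ne fun h => hj (Fin.ext h.symm)
  · simp
end
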